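/- arXiv:2101.06260 — 5 statements merged into one kernel-verified Lean document; each statement's English description precedes it below -/
import Mathlib

section
/- For all non-negative integers n and all integers r ≥ 2, b_{0,r}(n) = (r−1)·|O_{1,r}(n)| = (r−1)·|D_{1,r}(n)|; that is, the difference between the total number of parts in all partitions in O_{0,r}(n) and the total number of parts in all partitions in D_{0,r}(n) equals (r−1) times the number of partitions of n with exactly one different part divisible by r (Yang's Beck-type companion to Glaisher's identity). -/
open Finset

/-- The number of parts of a partition. -/
def numParts {n : ℕ} (p : Nat.Partition n) : ℕ := Multiset.card p.parts

/-- The number of different parts of a partition. -/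
def numDistinctParts {n : ℕ} (p : Nat.Partition n) : ℕ := p.parts.toFinset.card

/-- `O_{j,r}(n)`: partitions of `n` with exactly `j` different parts divisible by `r`. -/
def setO (j r n : ℕ) : Finset (Nat.Partition n) :=
  Finset.univ.filter fun p => (p.parts.toFinset.filter fun i => r ∣ i).card = j

/-- `D_{j,r}(n)`: partitions of `n` with exactly `j` different parts repeated at least `r`
times (all other parts appearing at most `r - 1` times). -/
def setD (j r n : ℕ) : Finset (Nat.Partition n) :=
  Finset.univ.filter fun p => (p.parts.toFinset.filter fun i => r ≤ p.parts.count i).card = j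

/-- `O_{≤j,r}(n)`: partitions of `n` with at most `j` different parts divisible by `r`. -/
def setOle (j r n : ℕ) : Finset (Nat.Partition n) :=
  Finset.univ.filter fun p => (p.parts.toFinset.filter fun i => r ∣ i).card ≤ j

/-- `D_{≤j,r}(n)`: partitions of `n` with at most `j` different parts repeated at least `r`
times (all other parts appearing at most `r - 1` times). -/
def setDle (j r n : ℕ) : Finset (Nat.Partition n) :=
  Finset.univ.filter fun p => (p.parts.toFinset.filter fun i => r ≤ p.parts.count i).card ≤ j

/-- `ℓ_t(λ)`: the number of parts of `λ` congruent to `t` modulo `r`, counted with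
multiplicity. -/
def ellMod {n : ℕ} (r t : ℕ) (p : Nat.Partition n) : ℕ :=
  Multiset.card (p.parts.filter fun i => i % r = t)

/-- `ℓ̄_t(λ)`: the number of different parts of `λ` whose residual multiplicity
(multiplicity mod `r`) is at least `t`. -/
def ellBarMod {n : ℕ} (r t : ℕ) (p : Nat.Partition n) : ℕ :=
  (p.parts.toFinset.filter fun i => t ≤ p.parts.count i % r).card

/-- `b_{j,r}(n)`: the difference between the number of parts in all partitions in
`O_{j,r}(n)` and the number of parts in all partitions in `D_{j,r}(n)`. -/
def bDiff (j r n : ℕ) : ℤ :=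
  (∑ p ∈ setO j r n, (numParts p : ℤ)) - ∑ p ∈ setD j r n, (numParts p : ℤ)

/-- `b_{≤j,r}(n)`. -/
def bDiffLe (j r n : ℕ) : ℤ :=
  (∑ p ∈ setOle j r n, (numParts p : ℤ)) - ∑ p ∈ setDle j r n, (numParts p : ℤ)

/-- `E_{j,r,t}(n)`. -/
def EDiff (j r t n : ℕ) : ℤ :=
  (∑ p ∈ setO j r n, ((ellMod r t p : ℤ) - (ellMod r 0 p : ℤ))) -
    ∑ p ∈ setD j r n, (ellBarMod r t p : ℤ)

/-- `b'_{j,r}(n)`: the difference between the number of different parts in all partitions in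
`D_{j,r}(n)` and the number of different parts in all partitions in `O_{j,r}(n)`. -/
def bDiff' (j r n : ℕ) : ℤ :=
  (∑ p ∈ setD j r n, (numDistinctParts p : ℤ)) - ∑ p ∈ setO j r n, (numDistinctParts p : ℤ)

/-- `b'_{≤j,r}(n)`. -/
def bDiffLe' (j r n : ℕ) : ℤ :=
  (∑ p ∈ setDle j r n, (numDistinctParts p : ℤ)) - ∑ p ∈ setOle j r n, (numDistinctParts p : ℤ)

/-- `T_{j,r}(n)`: the number of different parts with multiplicity between `r + 1` and
`2r - 1` in all partitions in `D_{j,r}(n)`. -/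
def Tcount (j r n : ℕ) : ℕ :=
  ∑ p ∈ setD j r n,
    (p.parts.toFinset.filter fun i =>
      r + 1 ≤ p.parts.count i ∧ p.parts.count i ≤ 2 * r - 1).card

/-- No part is divisible by `r`. -/
def OKO (r : ℕ) (s : Multiset ℕ) : Prop := ∀ i ∈ s, ¬ r ∣ i

/-- Every multiplicity is less than `r`. -/
def OKD (r : ℕ) (s : Multiset ℕ) : Prop := ∀ i, s.count i < r

theorem replicate_sum_sub {s : Multiset ℕ} {i m : ℕ} (h : m ≤ s.count i) :
    i * m ≤ s.sum ∧ (s - Multiset.replicate m i).sum = s.sum - i * m := by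
  have hle : Multiset.replicate m i ≤ s := Multiset.le_count_iff_replicate_le.mp h
  have h1 : (s - Multiset.replicate m i) + Multiset.replicate m i = s := tsub_add_cancel_of_le hle
  have h2 := congrArg Multiset.sum h1
  rw [Multiset.sum_add, Multiset.sum_replicate, smul_eq_mul, mul_comm] at h2
  omega

/-- Removing `m` copies of `i`. -/
theorem sum_remove (n i m : ℕ) (hi : 1 ≤ i) (φ : Multiset ℕ → ℤ) :
    (∑ p : Nat.Partition n,
      if m ≤ p.parts.count i then φ (p.parts - Multiset.replicate m i) else 0) =
    if i * m ≤ n then ∑ q : Nat.Partition (n - i * m), φ q.parts else 0 := by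
  split_ifs with h
  · rw [← Finset.sum_filter]
    refine Finset.sum_bij'
      (fun p hp => ⟨p.parts - Multiset.replicate m i, ?_, ?_⟩)
      (fun q _ => ⟨q.parts + Multiset.replicate m i, ?_, ?_⟩) ?_ ?_ ?_ ?_ ?_
    · intro j hj
      exact p.parts_pos (Multiset.mem_of_le tsub_le_self hj)
    · rw [(replicate_sum_sub (Finset.mem_filter.mp hp).2).2, p.parts_sum]
    · intro j hj
      rcases Multiset.mem_add.mp hj with hj | hj
      · exact q.parts_pos hj
      · rw [Multiset.eq_of_mem_replicate hj]; exact hi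
    · rw [Multiset.sum_add, q.parts_sum, Multiset.sum_replicate, smul_eq_mul, mul_comm m i]
      omega
    · intros; simp
    · intro q _; simp
    · intro p hp
      ext1
      simp only
      exact tsub_add_cancel_of_le
        (Multiset.le_count_iff_replicate_le.mp (Finset.mem_filter.mp hp).2)
    · intro q _
      ext1
      simp
    · intros; rfl
  · apply Finset.sum_eq_zero
    intro p _
    rw [if_neg]
    intro hm
    have := (replicate_sum_sub hm).1
    rw [p.parts_sum] at this
    exact h this

theorem sum_Icc_le (n c : ℕ) (hc : c ≤ n) :
    (∑ m ∈ Icc 1 n, if m ≤ c then (1 : ℤ) else 0) = c := by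
  rw [← Finset.sum_filter]
  have : (Icc 1 n).filter (fun m => m ≤ c) = Icc 1 c := by ext; simp; omega
  simp [this]

theorem sum_singleton (n : ℕ) (A : Finset ℕ) (g : ℕ → ℕ) (hg : Function.Injective g)
    (hA : ∀ a ∈ A, ∃ j ∈ Icc 1 n, g j = a) :
    (∑ j ∈ Icc 1 n, if A = {g j} then (1 : ℤ) else 0) = if A.card = 1 then 1 else 0 := by
  split_ifs with h
  · obtain ⟨a, ha⟩ := Finset.card_eq_one.mp h
    obtain ⟨j, hj, hja⟩ := hA a (by simp [ha])
    rw [Finset.sum_eq_single j]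
    · simp [ha, hja]
    · intro b _ hb
      rw [if_neg]
      rw [ha, ← hja]
      intro h'
      exact hb (hg (Finset.singleton_injective h')).symm
    · intro h'; exact absurd hj h'
  · apply Finset.sum_eq_zero
    intro j _
    rw [if_neg]
    intro h'
    exact h (by simp [h'])

theorem OKO_iff (r : ℕ) (s : Multiset ℕ) : OKO r s ↔ ∀ i, r ∣ i → s.count i = 0 := by
  unfold OKO
  constructor
  · intro h i hi
    rw [Multiset.count_eq_zero]
    exact fun h' => h i h' hi
  · intro h i hi hr
    exact (Multiset.count_eq_zero.mp (h i hr)) hi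

theorem count_rem (s : Multiset ℕ) (m a i : ℕ) :
    (s - Multiset.replicate m a).count i = if i = a then s.count a - m else s.count i := by
  rw [Multiset.count_sub, Multiset.count_replicate]
  split_ifs <;> simp_all

open Classical in
theorem point_O0 (n r : ℕ) (s : Multiset ℕ) (hs : ∀ i ∈ s, i ∈ Icc 1 n)
    (hc : ∀ i, s.count i ≤ n) :
    (if OKO r s then (s.card : ℤ) else 0) =
      ∑ i ∈ Icc 1 n, if r ∣ i then 0 else ∑ m ∈ Icc 1 n,
        if m ≤ s.count i then
          (if OKO r (s - Multiset.replicate m i) then (1 : ℤ) else 0) else 0 := by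
  have h1 : ∀ i ∈ Icc 1 n, (if r ∣ i then 0 else ∑ m ∈ Icc 1 n,
        if m ≤ s.count i then
          (if OKO r (s - Multiset.replicate m i) then (1 : ℤ) else 0) else 0) =
        if OKO r s then (s.count i : ℤ) else 0 := by
    intro i _
    split_ifs with h2 h3 h3
    · rw [(OKO_iff r s).mp h3 i h2]; rfl
    · rfl
    all_goals
      have h4 : ∀ m, OKO r (s - Multiset.replicate m i) ↔ OKO r s := by
        intro m
        simp only [OKO_iff, count_rem]
        refine forall_congr' fun j => forall_congr' fun hj => ?_
        rw [if_neg]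
        rintro rfl
        exact h2 hj
      simp only [h4, h3, if_true, if_false]
    · exact sum_Icc_le n _ (hc i)
    · simp
  rw [Finset.sum_congr rfl h1]
  split_ifs with h3
  · rw [← Nat.cast_sum, Multiset.sum_count_eq_card hs]
  · simp

open Classical in
theorem point_O1 (n r : ℕ) (hr : 2 ≤ r) (s : Multiset ℕ) (hs : ∀ i ∈ s, i ∈ Icc 1 n)
    (hc : ∀ i, s.count i ≤ n) :
    (if (s.toFinset.filter fun i => r ∣ i).card = 1 then (1 : ℤ) else 0) =
      ∑ j ∈ Icc 1 n, ∑ m ∈ Icc 1 n,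
        if m ≤ s.count (r * j) then
          (if OKO r (s - Multiset.replicate m (r * j)) then (1 : ℤ) else 0) else 0 := by
  rw [← sum_singleton n _ (fun j => r * j)
    (fun a b h => Nat.eq_of_mul_eq_mul_left (by omega) h)]
  · refine Finset.sum_congr rfl fun j _ => ?_
    have h4 : ∀ m ∈ Icc 1 n, (m ≤ s.count (r * j) ∧ OKO r (s - Multiset.replicate m (r * j))) ↔
        (m = s.count (r * j) ∧ (s.toFinset.filter fun i => r ∣ i) = {r * j}) := by
      intro m hm
      simp only [Finset.mem_Icc] at hm
      simp only [OKO_iff, count_rem]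
      constructor
      · rintro ⟨h1, h2⟩
        have h3 := h2 (r * j) (dvd_mul_right _ _)
        rw [if_pos rfl] at h3
        refine ⟨by omega, ?_⟩
        ext a
        simp only [Finset.mem_filter, Multiset.mem_toFinset, Finset.mem_singleton]
        constructor
        · rintro ⟨h5, h6⟩
          by_contra h7
          have h8 := h2 a h6
          rw [if_neg h7] at h8
          exact Multiset.count_eq_zero.mp h8 h5
        · rintro rfl
          exact ⟨Multiset.count_pos.mp (by omega), dvd_mul_right _ _⟩
      · rintro ⟨h1, h2⟩
        refine ⟨h1.le, fun i hi => ?_⟩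
        split_ifs with h3
        · omega
        · by_contra h5
          have h6 : i ∈ (s.toFinset.filter fun i => r ∣ i) := by
            simp only [Finset.mem_filter, Multiset.mem_toFinset]
            exact ⟨Multiset.count_pos.mp (by omega), hi⟩
          rw [h2] at h6
          exact h3 (Finset.mem_singleton.mp h6)
    simp only [← ite_and]
    rw [Finset.sum_congr rfl (fun m hm => by rw [if_congr (h4 m hm) rfl rfl])]
    simp only [ite_and]
    rw [Finset.sum_ite_eq']
    split_ifs with h1 h2 h2
    · rfl
    · exfalso
      apply h2
      have h6 : r * j ∈ (s.toFinset.filter fun i => r ∣ i) := by rw [h1]; simp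
      simp only [Finset.mem_filter, Multiset.mem_toFinset] at h6
      exact Finset.mem_Icc.mpr ⟨Multiset.count_pos.mpr h6.1, hc _⟩
    · rfl
    · rfl
  · intro a ha
    simp only [Finset.mem_filter, Multiset.mem_toFinset] at ha
    obtain ⟨h1, j, rfl⟩ := ha
    have := Finset.mem_Icc.mp (hs _ h1)
    refine ⟨j, Finset.mem_Icc.mpr ⟨?_, ?_⟩, rfl⟩
    · rcases Nat.eq_zero_or_pos j with h | h
      · subst h; omega
      · exact h
    · nlinarith

theorem OKD_rem (r a k : ℕ) (s : Multiset ℕ) : OKD r (s - Multiset.replicate k a) ↔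
    ((∀ i, i ≠ a → s.count i < r) ∧ s.count a - k < r) := by
  simp only [OKD, count_rem]
  constructor
  · intro h
    refine ⟨fun i hi => ?_, ?_⟩
    · simpa [hi] using h i
    · simpa using h a
  · rintro ⟨h1, h2⟩ i
    split_ifs with h
    · exact h2
    · exact h1 i h

theorem filterD_iff (r a : ℕ) (hr : 2 ≤ r) (s : Multiset ℕ) :
    (s.toFinset.filter fun i => r ≤ s.count i) = {a} ↔
    ((∀ i, i ≠ a → s.count i < r) ∧ r ≤ s.count a) := by
  constructor
  · intro h
    have h' : ∀ i, (i ∈ s ∧ r ≤ s.count i) ↔ i = a := by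
      intro i
      have := Finset.ext_iff.mp h i
      simpa only [Finset.mem_filter, Multiset.mem_toFinset, Finset.mem_singleton] using this
    refine ⟨fun i hi => ?_, ((h' a).mpr rfl).2⟩
    by_contra h2
    exact hi ((h' i).mp ⟨Multiset.count_pos.mp (by omega), by omega⟩)
  · rintro ⟨h1, h2⟩
    ext i
    simp only [Finset.mem_filter, Multiset.mem_toFinset, Finset.mem_singleton]
    constructor
    · rintro ⟨_, h4⟩
      by_contra h5
      have := h1 i h5
      omega
    · rintro rfl
      exact ⟨Multiset.count_pos.mp (by omega), h2⟩

open Classical in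
theorem inner_D1 (n r : ℕ) (hr : 2 ≤ r) (s : Multiset ℕ) (hc : ∀ i, s.count i ≤ n) (j : ℕ) :
    (∑ m ∈ Icc 1 n, if r * m ≤ s.count j then
          (if OKD r (s - Multiset.replicate (r * m) j) then (1 : ℤ) else 0) else 0) =
      if (s.toFinset.filter fun i => r ≤ s.count i) = {j} then (1 : ℤ) else 0 := by
  have h4 : ∀ m ∈ Icc 1 n, (r * m ≤ s.count j ∧ OKD r (s - Multiset.replicate (r * m) j)) ↔
      (m = s.count j / r ∧ (s.toFinset.filter fun i => r ≤ s.count i) = {j}) := by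
    intro m hm
    simp only [Finset.mem_Icc] at hm
    rw [OKD_rem, filterD_iff r j hr]
    have h5 : m = s.count j / r ↔ (r * m ≤ s.count j ∧ s.count j < r * m + r) := by
      rw [eq_comm, Nat.div_eq_iff (by omega)]
      rw [mul_comm m r]
      omega
    have h6 : r * 1 ≤ r * m := Nat.mul_le_mul_left r hm.1
    rw [h5]
    constructor
    · rintro ⟨h1, h2, h3⟩
      exact ⟨⟨h1, by omega⟩, h2, by omega⟩
    · rintro ⟨⟨h1, h2⟩, h3, h7⟩
      exact ⟨h1, h3, by omega⟩
  simp only [← ite_and]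
  rw [Finset.sum_congr rfl (fun m hm => by rw [if_congr (h4 m hm) rfl rfl])]
  simp only [ite_and]
  rw [Finset.sum_ite_eq']
  split_ifs with h1 h2 h2
  · rfl
  · rfl
  · exfalso
    apply h1
    rw [filterD_iff r j hr] at h2
    exact Finset.mem_Icc.mpr ⟨Nat.div_pos h2.2 (by omega), (Nat.div_le_self _ _).trans (hc _)⟩
  · rfl

open Classical in
theorem point_D1 (n r : ℕ) (hr : 2 ≤ r) (s : Multiset ℕ) (hs : ∀ i ∈ s, i ∈ Icc 1 n)
    (hc : ∀ i, s.count i ≤ n) :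
    (if (s.toFinset.filter fun i => r ≤ s.count i).card = 1 then (1 : ℤ) else 0) =
      ∑ j ∈ Icc 1 n, ∑ m ∈ Icc 1 n,
        if r * m ≤ s.count j then
          (if OKD r (s - Multiset.replicate (r * m) j) then (1 : ℤ) else 0) else 0 := by
  rw [← sum_singleton n _ (fun j => j) (fun a b h => h)]
  · exact Finset.sum_congr rfl fun j _ => (inner_D1 n r hr s hc j).symm
  · intro a ha
    simp only [Finset.mem_filter, Multiset.mem_toFinset] at ha
    exact ⟨a, hs _ ha.1, rfl⟩

open Classical in
theorem inner_D0 (n r : ℕ) (hr : 2 ≤ r) (s : Multiset ℕ) (hc : ∀ i, s.count i ≤ n) (j : ℕ) :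
    (∑ m ∈ Icc 1 n, if m ≤ s.count j then
          (if OKD r (s - Multiset.replicate m j) then (1 : ℤ) else 0) else 0) =
      (if OKD r s then (s.count j : ℤ) else 0) + r *
      if (s.toFinset.filter fun i => r ≤ s.count i) = {j} then (1 : ℤ) else 0 := by
  simp only [OKD_rem, filterD_iff r j hr]
  have h0 : OKD r s ↔ ((∀ i, i ≠ j → s.count i < r) ∧ s.count j < r) := by
    simpa using OKD_rem r j 0 s
  rw [if_congr h0 rfl rfl]
  generalize hQ : (∀ i, i ≠ j → s.count i < r) = Q
  by_cases h : Q
  · simp only [h, true_and]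
    have := hc j
    generalize s.count j = c at *
    rw [← Finset.sum_filter, ← Finset.sum_filter, Finset.filter_filter]
    by_cases hcr : c < r
    · have : (Icc 1 n).filter (fun m => m ≤ c ∧ c - m < r) = Icc 1 c := by
        ext; simp; omega
      rw [this]
      simp [hcr]
    · have : (Icc 1 n).filter (fun m => m ≤ c ∧ c - m < r) = Icc (c - r + 1) c := by
        ext; simp; omega
      rw [this]
      have h2 : c + 1 - (c - r + 1) = r := by omega
      simp [hcr, h2]
  · simp [h]

open Classical in
theorem point_D0 (n r : ℕ) (hr : 2 ≤ r) (s : Multiset ℕ) (hs : ∀ i ∈ s, i ∈ Icc 1 n)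
    (hc : ∀ i, s.count i ≤ n) :
    (if OKD r s then (s.card : ℤ) else 0) =
      (∑ j ∈ Icc 1 n, ∑ m ∈ Icc 1 n, if m ≤ s.count j then
          (if OKD r (s - Multiset.replicate m j) then (1 : ℤ) else 0) else 0) -
      r * ∑ j ∈ Icc 1 n, ∑ m ∈ Icc 1 n, if r * m ≤ s.count j then
          (if OKD r (s - Multiset.replicate (r * m) j) then (1 : ℤ) else 0) else 0 := by
  rw [Finset.mul_sum, ← Finset.sum_sub_distrib]
  simp only [inner_D1 n r hr s hc, inner_D0 n r hr s hc, add_sub_cancel_right]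
  split_ifs with h3
  · rw [← Nat.cast_sum, Multiset.sum_count_eq_card hs]
  · simp

/-- The shifted counting function. -/
def shiftF (r n k : ℕ) : ℤ :=
  if k ≤ n then ((Nat.Partition.restricted (n - k) (¬ r ∣ ·)).card : ℤ) else 0

open Classical in
theorem sum_O (r n i m : ℕ) (hi : 1 ≤ i) :
    (∑ p : Nat.Partition n, if m ≤ p.parts.count i then
      (if OKO r (p.parts - Multiset.replicate m i) then (1 : ℤ) else 0) else 0) =
    shiftF r n (i * m) := by
  rw [sum_remove n i m hi (fun s => if OKO r s then (1 : ℤ) else 0)]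
  unfold shiftF
  split_ifs
  · rw [Nat.Partition.restricted, Finset.card_filter, Nat.cast_sum]
    simp only [Nat.cast_ite, Nat.cast_one, Nat.cast_zero]
    exact Finset.sum_congr rfl fun q _ => if_congr Iff.rfl rfl rfl
  · rfl

theorem OKD_iff (r : ℕ) (hr : 2 ≤ r) (s : Multiset ℕ) : OKD r s ↔ ∀ i ∈ s, s.count i < r := by
  constructor
  · intro h i _
    exact h i
  · intro h i
    by_cases hi : i ∈ s
    · exact h i hi
    · rw [Multiset.count_eq_zero_of_notMem hi]; omega

open Classical in
theorem sum_D (r n i m : ℕ) (hr : 2 ≤ r) (hi : 1 ≤ i) :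
    (∑ p : Nat.Partition n, if m ≤ p.parts.count i then
      (if OKD r (p.parts - Multiset.replicate m i) then (1 : ℤ) else 0) else 0) =
    shiftF r n (i * m) := by
  rw [sum_remove n i m hi (fun s => if OKD r s then (1 : ℤ) else 0)]
  unfold shiftF
  rw [Nat.Partition.card_restricted_eq_card_countRestricted _ (by omega)]
  split_ifs
  · simp [Nat.Partition.countRestricted, OKD_iff r hr]
  · rfl

theorem parts_mem {n : ℕ} (p : Nat.Partition n) : ∀ i ∈ p.parts, i ∈ Icc 1 n := fun i hi =>
  Finset.mem_Icc.mpr ⟨p.parts_pos hi, p.parts_sum ▸ Multiset.le_sum_of_mem hi⟩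

theorem parts_count {n : ℕ} (p : Nat.Partition n) (i : ℕ) : p.parts.count i ≤ n := by
  by_cases hi : i ∈ p.parts
  · have h1 := (replicate_sum_sub (le_refl (p.parts.count i))).1
    rw [p.parts_sum] at h1
    have := p.parts_pos hi
    nlinarith
  · rw [Multiset.count_eq_zero_of_notMem hi]; omega

theorem card_O1 (n r : ℕ) (hr : 2 ≤ r) : ((setO 1 r n).card : ℤ) =
    ∑ j ∈ Icc 1 n, ∑ m ∈ Icc 1 n, shiftF r n (r * j * m) := by
  classical
  rw [setO, Finset.card_filter, Nat.cast_sum]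
  simp only [Nat.cast_ite, Nat.cast_one, Nat.cast_zero]
  rw [Finset.sum_congr rfl fun p _ => point_O1 n r hr p.parts (parts_mem p) (parts_count p)]
  rw [Finset.sum_comm]
  refine Finset.sum_congr rfl fun j hj => ?_
  rw [Finset.sum_comm]
  refine Finset.sum_congr rfl fun m hm => ?_
  refine sum_O r n (r * j) m ?_
  have := (Finset.mem_Icc.mp hj).1
  nlinarith

theorem card_D1 (n r : ℕ) (hr : 2 ≤ r) : ((setD 1 r n).card : ℤ) =
    ∑ j ∈ Icc 1 n, ∑ m ∈ Icc 1 n, shiftF r n (r * j * m) := by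
  classical
  rw [setD, Finset.card_filter, Nat.cast_sum]
  simp only [Nat.cast_ite, Nat.cast_one, Nat.cast_zero]
  rw [Finset.sum_congr rfl fun p _ => point_D1 n r hr p.parts (parts_mem p) (parts_count p)]
  rw [Finset.sum_comm]
  refine Finset.sum_congr rfl fun j hj => ?_
  rw [Finset.sum_comm]
  refine Finset.sum_congr rfl fun m hm => ?_
  rw [sum_D r n j (r * m) hr (Finset.mem_Icc.mp hj).1]
  congr 1
  ring

theorem sum_O0 (n r : ℕ) : ∑ p ∈ setO 0 r n, (numParts p : ℤ) =
    ∑ i ∈ Icc 1 n, if r ∣ i then 0 else ∑ m ∈ Icc 1 n, shiftF r n (i * m) := by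
  classical
  rw [setO, Finset.sum_filter]
  simp only [numParts]
  have h : ∀ p : Nat.Partition n, (p.parts.toFinset.filter fun i => r ∣ i).card = 0 ↔
      OKO r p.parts := by
    intro p
    simp [OKO, Finset.filter_eq_empty_iff]
  rw [Finset.sum_congr rfl fun p _ => (if_congr (h p) rfl rfl).trans
    (point_O0 n r p.parts (parts_mem p) (parts_count p))]
  rw [Finset.sum_comm]
  refine Finset.sum_congr rfl fun i hi => ?_
  split_ifs
  · simp
  · rw [Finset.sum_comm]
    exact Finset.sum_congr rfl fun m hm => sum_O r n i m (Finset.mem_Icc.mp hi).1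

theorem sum_D0 (n r : ℕ) (hr : 2 ≤ r) : ∑ p ∈ setD 0 r n, (numParts p : ℤ) =
    (∑ i ∈ Icc 1 n, ∑ m ∈ Icc 1 n, shiftF r n (i * m)) -
      r * ∑ j ∈ Icc 1 n, ∑ m ∈ Icc 1 n, shiftF r n (r * j * m) := by
  classical
  rw [setD, Finset.sum_filter]
  simp only [numParts]
  have h : ∀ p : Nat.Partition n, (p.parts.toFinset.filter fun i => r ≤ p.parts.count i).card = 0 ↔
      OKD r p.parts := by
    intro p
    simp [OKD_iff r hr, Finset.filter_eq_empty_iff]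
  rw [Finset.sum_congr rfl fun p _ => (if_congr (h p) rfl rfl).trans
    (point_D0 n r hr p.parts (parts_mem p) (parts_count p))]
  rw [Finset.sum_sub_distrib, ← Finset.mul_sum]
  congr 1
  · rw [Finset.sum_comm]
    refine Finset.sum_congr rfl fun i hi => ?_
    rw [Finset.sum_comm]
    exact Finset.sum_congr rfl fun m hm => sum_D r n i m hr (Finset.mem_Icc.mp hi).1
  · congr 1
    rw [Finset.sum_comm]
    refine Finset.sum_congr rfl fun j hj => ?_
    rw [Finset.sum_comm]
    refine Finset.sum_congr rfl fun m hm => ?_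
    rw [sum_D r n j (r * m) hr (Finset.mem_Icc.mp hj).1]
    congr 1
    ring

theorem sum_multiples (n r : ℕ) (hr : 2 ≤ r) :
    (∑ i ∈ Icc 1 n, if r ∣ i then ∑ m ∈ Icc 1 n, shiftF r n (i * m) else 0) =
      ∑ j ∈ Icc 1 n, ∑ m ∈ Icc 1 n, shiftF r n (r * j * m) := by
  rw [← Finset.sum_filter]
  symm
  have h1 : ∑ j ∈ Icc 1 n, ∑ m ∈ Icc 1 n, shiftF r n (r * j * m) =
      ∑ j ∈ (Icc 1 n).filter (fun j => r * j ≤ n), ∑ m ∈ Icc 1 n, shiftF r n (r * j * m) := by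
    symm
    apply Finset.sum_subset (Finset.filter_subset _ _)
    intro j hj hj'
    apply Finset.sum_eq_zero
    intro m hm
    have hm1 := (Finset.mem_Icc.mp hm).1
    have : ¬ r * j ≤ n := fun h => hj' (Finset.mem_filter.mpr ⟨hj, h⟩)
    rw [shiftF, if_neg]
    nlinarith
  rw [h1]
  refine Finset.sum_bij (fun j _ => r * j) ?_ ?_ ?_ ?_
  · intro j hj
    simp only [Finset.mem_filter, Finset.mem_Icc] at hj ⊢
    exact ⟨⟨by nlinarith, hj.2⟩, dvd_mul_right _ _⟩
  · intro a _ b _ h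
    exact Nat.eq_of_mul_eq_mul_left (by omega) h
  · intro b hb
    simp only [Finset.mem_filter, Finset.mem_Icc] at hb
    obtain ⟨⟨h2, h3⟩, j, rfl⟩ := hb
    have hj : 1 ≤ j := by
      rcases Nat.eq_zero_or_pos j with h | h
      · subst h; omega
      · exact h
    refine ⟨j, ?_, rfl⟩
    simp only [Finset.mem_filter, Finset.mem_Icc]
    exact ⟨⟨hj, by nlinarith⟩, h3⟩
  · intros; rfl

theorem bDiff_eq (n r : ℕ) (hr : 2 ≤ r) : bDiff 0 r n =
    ((r : ℤ) - 1) * ∑ j ∈ Icc 1 n, ∑ m ∈ Icc 1 n, shiftF r n (r * j * m) := by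
  rw [bDiff, sum_O0, sum_D0 n r hr]
  have h : (∑ i ∈ Icc 1 n, ∑ m ∈ Icc 1 n, shiftF r n (i * m)) =
      (∑ i ∈ Icc 1 n, if r ∣ i then 0 else ∑ m ∈ Icc 1 n, shiftF r n (i * m)) +
      ∑ i ∈ Icc 1 n, if r ∣ i then ∑ m ∈ Icc 1 n, shiftF r n (i * m) else 0 := by
    rw [← Finset.sum_add_distrib]
    refine Finset.sum_congr rfl fun i _ => ?_
    split_ifs <;> simp
  rw [h, sum_multiples n r hr]
  ring

/-- Yang's Beck-type companion to Glaisher's identity: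
`b_{0,r}(n) = (r-1)·|O_{1,r}(n)| = (r-1)·|D_{1,r}(n)|`. -/
theorem yang_beck (n r : ℕ) (hr : 2 ≤ r) :
    bDiff 0 r n = ((r : ℤ) - 1) * ((setO 1 r n).card : ℤ) ∧
      bDiff 0 r n = ((r : ℤ) - 1) * ((setD 1 r n).card : ℤ) := by
  rw [card_O1 n r hr, card_D1 n r hr]
  exact ⟨bDiff_eq n r hr, bDiff_eq n r hr⟩
end

section
/- For all non-negative integers n, j and all integers r ≥ 2, b_{≤j,r}(n) = (r−1)·(j+1)·|O_{j+1,r}(n)|. -/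
open Finset

/-- Number of different parts divisible by `r`. -/
def oCnt (r : ℕ) {n : ℕ} (p : Nat.Partition n) : Finset ℕ :=
  p.parts.toFinset.filter fun i => r ∣ i

/-- Different parts repeated at least `r` times. -/
def dCnt (r : ℕ) {n : ℕ} (p : Nat.Partition n) : Finset ℕ :=
  p.parts.toFinset.filter fun i => r ≤ p.parts.count i

lemma oCnt_le {r n : ℕ} {p : Nat.Partition n} {S : Finset ℕ} (h : S ⊆ oCnt r p) :
    S.val ≤ p.parts := by
  rw [Multiset.le_iff_subset S.nodup]
  intro x hx
  have := h (show x ∈ S from hx)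
  simp only [oCnt, Finset.mem_filter, Multiset.mem_toFinset] at this
  exact this.1

lemma dCnt_le {r n : ℕ} {p : Nat.Partition n} {T : Finset ℕ} (h : T ⊆ dCnt r p) :
    r • T.val ≤ p.parts := by
  rw [Multiset.le_iff_count]
  intro x
  rw [Multiset.count_nsmul]
  by_cases hx : x ∈ T
  · have := h hx
    simp only [dCnt, Finset.mem_filter, Multiset.mem_toFinset] at this
    rw [Multiset.count_eq_one_of_mem T.nodup hx]
    simpa using this.2
  · rw [Multiset.count_eq_zero_of_notMem (by simpa using hx)]
    simp

lemma image_div_mul {r : ℕ} (hr : 0 < r) (T : Finset ℕ) :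
    (T.image (r * ·)).image (· / r) = T := by
  rw [Finset.image_image]
  conv_rhs => rw [← Finset.image_id (s := T)]
  apply Finset.image_congr
  intro x _
  simp [hr]

lemma image_mul_div {r : ℕ} {S : Finset ℕ} (h : ∀ x ∈ S, r ∣ x) :
    (S.image (· / r)).image (r * ·) = S := by
  rw [Finset.image_image]
  conv_rhs => rw [← Finset.image_id (s := S)]
  apply Finset.image_congr
  intro x hx
  exact Nat.mul_div_cancel' (h x hx)

lemma sum_val_image_mul {r : ℕ} (hr : 0 < r) (T : Finset ℕ) :
    (T.image (r * ·)).val.sum = (r • T.val).sum := by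
  have h1 : (T.image (r * ·)).val.sum = ∑ x ∈ T.image (r * ·), x :=
    (Finset.sum_val _)
  rw [h1, Finset.sum_image (fun _ _ _ _ h => Nat.eq_of_mul_eq_mul_left hr h), ← Finset.mul_sum,
    Multiset.sum_nsmul, Finset.sum_val]
  rfl

lemma card_image_mul {r : ℕ} (hr : 0 < r) (T : Finset ℕ) :
    (T.image (r * ·)).card = T.card :=
  Finset.card_image_of_injective _ (fun _ _ h => Nat.eq_of_mul_eq_mul_left hr h)

/-- Replace a multiset of parts by another one with the same sum. -/
def swapParts {n : ℕ} (p : Nat.Partition n) (A B : Multiset ℕ) (hA : A ≤ p.parts)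
    (hs : A.sum = B.sum) (hB : ∀ i ∈ B, 0 < i) : Nat.Partition n where
  parts := p.parts - A + B
  parts_pos := by
    intro i hi
    rcases Multiset.mem_add.1 hi with h | h
    · exact p.parts_pos (Multiset.mem_of_le (Multiset.sub_le_self _ _) h)
    · exact hB i h
  parts_sum := by
    rw [Multiset.sum_add, ← hs, ← Multiset.sum_add, Multiset.sub_add_cancel hA, p.parts_sum]

lemma pair_sum (n r k : ℕ) (hr : 0 < r) (g : ℤ → ℤ) :
    ∑ x ∈ (univ : Finset (Nat.Partition n)).sigma (fun p => (oCnt r p).powersetCard k),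
      g ((numParts x.1 : ℤ) + ((r : ℤ) - 1) * k) =
    ∑ x ∈ (univ : Finset (Nat.Partition n)).sigma (fun p => (dCnt r p).powersetCard k),
      g (numParts x.1 : ℤ) := by
  have memO : ∀ x : (_ : Nat.Partition n) × Finset ℕ,
      x ∈ (univ : Finset (Nat.Partition n)).sigma (fun p => (oCnt r p).powersetCard k) ↔
      x.2 ⊆ oCnt r x.1 ∧ x.2.card = k := by
    intro x; simp [Finset.mem_powersetCard]
  have memD : ∀ x : (_ : Nat.Partition n) × Finset ℕ,
      x ∈ (univ : Finset (Nat.Partition n)).sigma (fun p => (dCnt r p).powersetCard k) ↔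
      x.2 ⊆ dCnt r x.1 ∧ x.2.card = k := by
    intro x; simp [Finset.mem_powersetCard]
  have dvdO : ∀ {p : Nat.Partition n} {S : Finset ℕ}, S ⊆ oCnt r p → ∀ x ∈ S, r ∣ x := by
    intro p S h x hx
    have := h hx
    simp only [oCnt, Finset.mem_filter] at this
    exact this.2
  have posO : ∀ {p : Nat.Partition n} {S : Finset ℕ}, S ⊆ oCnt r p → ∀ x ∈ S, 0 < x := by
    intro p S h x hx
    have := h hx
    simp only [oCnt, Finset.mem_filter, Multiset.mem_toFinset] at this
    exact p.parts_pos this.1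
  have posD : ∀ {p : Nat.Partition n} {S : Finset ℕ}, S ⊆ dCnt r p → ∀ x ∈ S, 0 < x := by
    intro p S h x hx
    have := h hx
    simp only [dCnt, Finset.mem_filter, Multiset.mem_toFinset] at this
    exact p.parts_pos this.1
  refine Finset.sum_bij'
    (fun x hx => ⟨swapParts x.1 x.2.val (r • (x.2.image (· / r)).val)
        (oCnt_le ((memO x).1 hx).1)
        (by
          have := sum_val_image_mul hr (x.2.image (· / r))
          rwa [image_mul_div (dvdO ((memO x).1 hx).1)] at this)
        (by
          intro i hi
          have hi := Multiset.mem_of_mem_nsmul hi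
          rw [Finset.mem_val, Finset.mem_image] at hi
          obtain ⟨a, ha, rfl⟩ := hi
          exact Nat.div_pos (Nat.le_of_dvd (posO ((memO x).1 hx).1 a ha)
            (dvdO ((memO x).1 hx).1 a ha)) hr), x.2.image (· / r)⟩)
    (fun x hx => ⟨swapParts x.1 (r • x.2.val) (x.2.image (r * ·)).val
        (dCnt_le ((memD x).1 hx).1)
        (sum_val_image_mul hr x.2).symm
        (by
          intro i hi
          rw [Finset.mem_val, Finset.mem_image] at hi
          obtain ⟨a, ha, rfl⟩ := hi
          exact Nat.mul_pos hr (posD ((memD x).1 hx).1 a ha)), x.2.image (r * ·)⟩)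
    ?_ ?_ ?_ ?_ ?_
  · intro x hx
    rw [memD]
    have hx' := (memO x).1 hx
    constructor
    · intro i hi
      have hi' : i ∈ (x.2.image (· / r)) := hi
      have hc : r ≤ Multiset.count i (x.1.parts - x.2.val + r • (x.2.image (· / r)).val) := by
        rw [Multiset.count_add, Multiset.count_nsmul,
          Multiset.count_eq_one_of_mem (Finset.nodup _) hi']
        simp
      exact Finset.mem_filter.2
        ⟨Multiset.mem_toFinset.2 (Multiset.count_pos.1 (lt_of_lt_of_le hr hc)), hc⟩
    · show (x.2.image (· / r)).card = k
      rw [← hx'.2, ← card_image_mul hr, image_mul_div (dvdO hx'.1)]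
  · intro x hx
    rw [memO]
    have hx' := (memD x).1 hx
    constructor
    · intro i hi
      have hi' : i ∈ (x.2.image (r * ·)) := hi
      simp only [oCnt, Finset.mem_filter, Multiset.mem_toFinset, swapParts]
      refine ⟨Multiset.mem_add.2 (Or.inr hi'), ?_⟩
      obtain ⟨a, _, rfl⟩ := Finset.mem_image.1 hi'
      exact dvd_mul_right _ _
    · show (x.2.image (r * ·)).card = k
      rw [card_image_mul hr, hx'.2]
  · intro x hx
    have hx' := (memO x).1 hx
    refine Sigma.ext ?_ (heq_of_eq ?_)
    · apply Nat.Partition.ext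
      simp only [swapParts]
      rw [image_mul_div (dvdO hx'.1), Multiset.add_sub_cancel_right,
        Multiset.sub_add_cancel (oCnt_le hx'.1)]
    · exact image_mul_div (dvdO hx'.1)
  · intro x hx
    have hx' := (memD x).1 hx
    refine Sigma.ext ?_ (heq_of_eq ?_)
    · apply Nat.Partition.ext
      simp only [swapParts]
      rw [image_div_mul hr, Multiset.add_sub_cancel_right,
        Multiset.sub_add_cancel (dCnt_le hx'.1)]
    · exact image_div_mul hr _
  · intro x hx
    have hx' := (memO x).1 hx
    congr 1
    have hle := oCnt_le hx'.1
    have hc : (x.2.image (· / r)).card = k := by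
      rw [← hx'.2, ← card_image_mul hr, image_mul_div (dvdO hx'.1)]
    simp only [numParts, swapParts, Multiset.card_add, Multiset.card_nsmul, Finset.card_val, hc]
    have h2 := Multiset.card_le_card hle
    rw [Multiset.card_sub hle]
    rw [Finset.card_val, hx'.2] at *
    push_cast [Nat.cast_sub h2]
    ring

lemma choose_sum (n r k : ℕ) (hr : 0 < r) :
    ∑ p : Nat.Partition n, ((oCnt r p).card.choose k : ℤ) * ((numParts p : ℤ) + ((r : ℤ) - 1) * k) =
    ∑ p : Nat.Partition n, ((dCnt r p).card.choose k : ℤ) * (numParts p : ℤ) := by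
  have := pair_sum n r k hr id
  rw [Finset.sum_sigma, Finset.sum_sigma] at this
  simpa [Finset.card_powersetCard] using this

lemma newton (f : ℕ → ℤ) (N m : ℕ) (h : m ≤ N) :
    f m = ∑ k ∈ range (N + 1), (m.choose k : ℤ) * (fwdDiff 1)^[k] f 0 := by
  have := shift_eq_sum_fwdDiff_iter (1 : ℕ) f m 0
  simp only [smul_eq_mul, mul_one, zero_add, nsmul_eq_mul] at this
  rw [this]
  apply Finset.sum_subset
  · intro x; simp; omega
  · intro x _ hx
    rw [Nat.choose_eq_zero_of_lt (by simpa using hx)]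
    simp

lemma newton_deriv (f : ℕ → ℤ) (N m : ℕ) (h : m ≤ N) :
    m * (f m - f (m - 1)) =
      ∑ k ∈ range (N + 1), (m.choose k : ℤ) * k * (fwdDiff 1)^[k] f 0 := by
  rw [newton f N m h, newton f N (m - 1) (by omega), ← Finset.sum_sub_distrib, Finset.mul_sum]
  apply Finset.sum_congr rfl
  intro k _
  rw [← sub_mul, ← mul_assoc]
  congr 1
  rcases m with _ | m
  · rcases k with _ | k <;> simp
  rcases k with _ | k
  · simp
  have h1 : ((m + 1) * m.choose k : ℤ) = (m + 1).choose (k + 1) * (k + 1) := by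
    exact_mod_cast Nat.add_one_mul_choose_eq m k
  have h2 : ((m + 1).choose (k + 1) : ℤ) = m.choose k + m.choose (k + 1) := by
    exact_mod_cast Nat.choose_succ_succ m k
  push_cast [Nat.add_sub_cancel]
  rw [← h1, h2]
  ring

lemma card_toFinset_le {n : ℕ} (p : Nat.Partition n) : p.parts.toFinset.card ≤ n := by
  refine (Multiset.toFinset_card_le _).trans ?_
  have := Multiset.card_nsmul_le_sum (s := p.parts) (a := 1) (fun x hx => p.parts_pos hx)
  rw [p.parts_sum] at this
  simpa using this

lemma general (n r : ℕ) (hr : 0 < r) (f : ℕ → ℤ) :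
    ∑ p : Nat.Partition n, f (oCnt r p).card * (numParts p : ℤ) +
    ((r : ℤ) - 1) * ∑ p : Nat.Partition n,
      ((oCnt r p).card : ℤ) * (f (oCnt r p).card - f ((oCnt r p).card - 1)) =
    ∑ p : Nat.Partition n, f (dCnt r p).card * (numParts p : ℤ) := by
  have ho : ∀ p : Nat.Partition n, (oCnt r p).card ≤ n := fun p =>
    (Finset.card_filter_le _ _).trans (card_toFinset_le p)
  have hd : ∀ p : Nat.Partition n, (dCnt r p).card ≤ n := fun p =>
    (Finset.card_filter_le _ _).trans (card_toFinset_le p)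
  have e1 : ∑ p : Nat.Partition n, f (dCnt r p).card * (numParts p : ℤ) =
      ∑ k ∈ range (n + 1), (fwdDiff 1)^[k] f 0 *
        ∑ p : Nat.Partition n, ((dCnt r p).card.choose k : ℤ) * (numParts p : ℤ) := by
    simp_rw [Finset.mul_sum]
    rw [Finset.sum_comm]
    apply Finset.sum_congr rfl
    intro p _
    rw [newton f n _ (hd p), Finset.sum_mul]
    apply Finset.sum_congr rfl
    intros; ring
  rw [e1]
  simp_rw [← choose_sum n r _ hr, Finset.mul_sum]
  rw [Finset.sum_comm, ← Finset.sum_add_distrib]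
  apply Finset.sum_congr rfl
  intro p _
  rw [newton_deriv f n _ (ho p), newton f n _ (ho p), Finset.sum_mul, Finset.mul_sum,
    ← Finset.sum_add_distrib]
  apply Finset.sum_congr rfl
  intros; ring

/-- `b_{≤j,r}(n) = (r-1)·(j+1)·|O_{j+1,r}(n)|`. -/
theorem bDiffLe_eq_O (n j r : ℕ) (hr : 2 ≤ r) :
    bDiffLe j r n = ((r : ℤ) - 1) * ((j : ℤ) + 1) * ((setO (j + 1) r n).card : ℤ) := by
  have h := general n r (by omega) (fun m => if m ≤ j then 1 else 0)
  have e1 : ∑ p : Nat.Partition n, (if (oCnt r p).card ≤ j then (1 : ℤ) else 0) * (numParts p : ℤ)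
      = ∑ p ∈ setOle j r n, (numParts p : ℤ) := by
    rw [setOle, Finset.sum_filter]
    apply Finset.sum_congr rfl
    intro p _
    change _ = if (oCnt r p).card ≤ j then _ else _
    split_ifs <;> simp
  have e2 : ∑ p : Nat.Partition n, (if (dCnt r p).card ≤ j then (1 : ℤ) else 0) * (numParts p : ℤ)
      = ∑ p ∈ setDle j r n, (numParts p : ℤ) := by
    rw [setDle, Finset.sum_filter]
    apply Finset.sum_congr rfl
    intro p _
    change _ = if (dCnt r p).card ≤ j then _ else _
    split_ifs <;> simp
  have e3 : ∑ p : Nat.Partition n, ((oCnt r p).card : ℤ) *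
      ((if (oCnt r p).card ≤ j then (1 : ℤ) else 0) -
        (if (oCnt r p).card - 1 ≤ j then (1 : ℤ) else 0))
      = - (((j : ℤ) + 1) * ((setO (j + 1) r n).card : ℤ)) := by
    rw [Finset.cast_card, setO, Finset.sum_filter, Finset.mul_sum, ← Finset.sum_neg_distrib]
    apply Finset.sum_congr rfl
    intro p _
    change _ = -(((j : ℤ) + 1) * if (oCnt r p).card = j + 1 then 1 else 0)
    generalize (oCnt r p).card = m
    by_cases h1 : m = j + 1
    · subst h1; simp
    · by_cases h2 : m ≤ j
      · have : m - 1 ≤ j := by omega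
        simp only [h1, h2, this, if_true, if_false]; simp
      · have : ¬ (m - 1 ≤ j) := by omega
        simp only [h1, h2, this, if_false]; simp
  simp only [e1, e2, e3] at h
  rw [bDiffLe]
  linarith
end

section
/- For all non-negative integers n and all integers r ≥ 2, b'_{0,r}(n) = T_{1,r}(n); that is, the difference between the total number of different parts in all partitions in D_{0,r}(n) and the total number of different parts in all partitions in O_{0,r}(n) equals the number of different parts with multiplicity between r+1 and 2r−1 in all partitions in D_{1,r}(n) (Yang's second Beck-type identity). -/
open Finset

open Classical in
/-- partitions of `n` whose multiset of parts satisfies `Q` -/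
noncomputable def cntSet (n : ℕ) (Q : Multiset ℕ → Prop) : Finset (Nat.Partition n) :=
  (Finset.univ : Finset (Nat.Partition n)).filter fun p => Q p.parts

lemma mem_cntSet {n : ℕ} {Q : Multiset ℕ → Prop} {p : Nat.Partition n} :
    p ∈ cntSet n Q ↔ Q p.parts := by
  simp [cntSet]

/-- number of partitions of `n` whose multiset of parts satisfies `Q` -/
noncomputable def cnt (n : ℕ) (Q : Multiset ℕ → Prop) : ℕ := (cntSet n Q).card

lemma cnt_congr (n : ℕ) {Q Q' : Multiset ℕ → Prop} (h : ∀ s, Q s ↔ Q' s) :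
    cnt n Q = cnt n Q' := by
  have : Q = Q' := funext fun s => propext (h s)
  rw [this]

lemma cnt_split (n : ℕ) {Q Q1 Q2 : Multiset ℕ → Prop} (h : ∀ s, Q s ↔ Q1 s ∨ Q2 s)
    (hd : ∀ s, Q1 s → ¬ Q2 s) : cnt n Q = cnt n Q1 + cnt n Q2 := by
  classical
  unfold cnt
  rw [← Finset.card_union_of_disjoint]
  · congr 1
    ext p
    simp [h, mem_cntSet]
  · rw [Finset.disjoint_left]
    intro p h1 h2
    exact hd _ (mem_cntSet.1 h1) (mem_cntSet.1 h2)

lemma cnt_false (n : ℕ) {Q : Multiset ℕ → Prop} (h : ∀ s, ¬ Q s) : cnt n Q = 0 := by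
  classical
  unfold cnt
  simp [h, cntSet]

lemma sum_eq_cnt (n : ℕ) (X : Multiset ℕ → Prop) (S : Finset (Nat.Partition n))
    (hS : ∀ p, p ∈ S ↔ X p.parts) (R : Multiset ℕ → ℕ → Prop)
    (f : Nat.Partition n → Finset ℕ)
    (hf : ∀ p i, i ∈ f p ↔ i ∈ p.parts ∧ R p.parts i) :
    ∑ p ∈ S, (f p).card = ∑ i ∈ Finset.Icc 1 n, cnt n (fun s => X s ∧ i ∈ s ∧ R s i) := by
  classical
  have h1 : ∀ p ∈ S, (f p).card = ∑ i ∈ Finset.Icc 1 n, if (i ∈ p.parts ∧ R p.parts i) then 1 else 0 := by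
    intro p _
    rw [← Finset.card_filter]
    congr 1
    ext i
    rw [hf, Finset.mem_filter, Finset.mem_Icc]
    constructor
    · intro h
      refine ⟨⟨p.parts_pos h.1, ?_⟩, h⟩
      have := Multiset.le_sum_of_mem h.1
      rwa [p.parts_sum] at this
    · exact fun h => h.2
  rw [Finset.sum_congr rfl h1, Finset.sum_comm]
  refine Finset.sum_congr rfl fun i _ => ?_
  rw [← Finset.card_filter]
  unfold cnt
  congr 1
  ext p
  simp [hS, mem_cntSet]

/-- Removing `k` copies of `i`. -/
lemma cnt_shift (n k i : ℕ) (hi : 0 < i) (Q : Multiset ℕ → Prop) :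
    cnt n (fun s => k ≤ s.count i ∧ Q (s - Multiset.replicate k i)) =
      if k * i ≤ n then cnt (n - k * i) Q else 0 := by
  classical
  split_ifs with h
  · unfold cnt
    refine Finset.card_bij'
      (fun p hp => ⟨p.parts - Multiset.replicate k i, ?_, ?_⟩)
      (fun p hp => ⟨p.parts + Multiset.replicate k i, ?_, ?_⟩) ?_ ?_ ?_ ?_
    · intro j hj
      exact p.parts_pos (Multiset.mem_of_le (Multiset.sub_le_self _ _) hj)
    · have hle : Multiset.replicate k i ≤ p.parts :=
        Multiset.le_count_iff_replicate_le.1 (mem_cntSet.1 hp).1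
      have h2 := congrArg Multiset.sum (Multiset.sub_add_cancel hle)
      rw [Multiset.sum_add, p.parts_sum, Multiset.sum_replicate, smul_eq_mul] at h2
      omega
    · intro j hj
      rcases Multiset.mem_add.1 hj with hj | hj
      · exact p.parts_pos hj
      · rw [Multiset.eq_of_mem_replicate hj]; exact hi
    · rw [Multiset.sum_add, p.parts_sum, Multiset.sum_replicate, smul_eq_mul]
      omega
    · intro p hp
      exact mem_cntSet.2 (mem_cntSet.1 hp).2
    · intro p hp
      have := mem_cntSet.1 hp
      simp [mem_cntSet, this]
    · intro p hp
      have hle : Multiset.replicate k i ≤ p.parts :=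
        Multiset.le_count_iff_replicate_le.1 (mem_cntSet.1 hp).1
      ext1
      exact Multiset.sub_add_cancel hle
    · intro p hp
      ext1
      simp
  · unfold cnt
    rw [Finset.card_eq_zero, Finset.eq_empty_iff_forall_notMem]
    intro p hp
    replace hp := mem_cntSet.1 hp
    have hle : Multiset.replicate k i ≤ p.parts := Multiset.le_count_iff_replicate_le.1 hp.1
    have h2 := congrArg Multiset.sum (Multiset.sub_add_cancel hle)
    rw [Multiset.sum_add, p.parts_sum, Multiset.sum_replicate, smul_eq_mul] at h2
    omega

/-- no part repeated `r` or more times -/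
def DZ (r : ℕ) (s : Multiset ℕ) : Prop := ∀ j, s.count j < r

/-- no part divisible by `r` -/
def OZ (r : ℕ) (s : Multiset ℕ) : Prop := ∀ j ∈ s, ¬ r ∣ j

lemma glaisher (n r : ℕ) (hr : 0 < r) : cnt n (DZ r) = cnt n (OZ r) := by
  classical
  have h := Nat.Partition.card_restricted_eq_card_countRestricted n hr
  unfold cnt
  unfold Nat.Partition.restricted Nat.Partition.countRestricted at h
  convert h.symm using 2
  · ext p
    simp only [mem_cntSet, Finset.mem_filter, Finset.mem_univ, true_and, DZ]
    constructor
    · exact fun h i _ => h i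
    · intro h i
      by_cases hi : i ∈ p.parts
      · exact h i hi
      · rw [Multiset.count_eq_zero_of_notMem hi]; exact hr
  · ext p
    simp [mem_cntSet, OZ]

lemma DZ_sub (r k i : ℕ) (s : Multiset ℕ) :
    DZ r (s - Multiset.replicate k i) ↔ s.count i - k < r ∧ ∀ j, j ≠ i → s.count j < r := by
  unfold DZ
  simp only [Multiset.count_sub, Multiset.count_replicate]
  constructor
  · intro h
    refine ⟨by simpa using h i, fun j hj => by simpa [Ne.symm hj] using h j⟩
  · rintro ⟨h1, h2⟩ j
    by_cases hj : j = i
    · subst hj; simpa using h1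
    · simpa [Ne.symm hj] using h2 j hj

lemma DZ_iff (r i : ℕ) (s : Multiset ℕ) :
    DZ r s ↔ s.count i < r ∧ ∀ j, j ≠ i → s.count j < r := by
  simpa using DZ_sub r 0 i s

/-- exactly one part repeated `r` or more times -/
def DOne (r : ℕ) (s : Multiset ℕ) : Prop :=
  (s.toFinset.filter fun i => r ≤ s.count i).card = 1

lemma DOne_iff (r i : ℕ) (hr : 0 < r) (s : Multiset ℕ) (hi : r ≤ s.count i) :
    DOne r s ↔ ∀ j, j ≠ i → s.count j < r := by
  unfold DOne
  have hm : ∀ j, j ∈ (s.toFinset.filter fun i => r ≤ s.count i) ↔ r ≤ s.count j := by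
    intro j
    simp only [Finset.mem_filter, Multiset.mem_toFinset, and_iff_right_iff_imp]
    intro h
    exact Multiset.count_pos.1 (by omega)
  rw [Finset.card_eq_one]
  constructor
  · rintro ⟨a, ha⟩ j hj
    rw [ha] at hm
    simp only [Finset.mem_singleton] at hm
    by_contra hc
    have h1 := (hm j).2 (by omega)
    have h2 := (hm i).2 hi
    exact hj (h1.trans h2.symm)
  · intro h
    refine ⟨i, ?_⟩
    ext j
    rw [hm, Finset.mem_singleton]
    constructor
    · intro h'
      by_contra hc
      have := h j hc
      omega
    · rintro rfl; exact hi

lemma key (n r i : ℕ) (hr : 2 ≤ r) :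
    cnt n (fun s => DZ r s ∧ i ∈ s ∧ True) +
      cnt n (fun s => r ≤ s.count i ∧ DZ r (s - Multiset.replicate r i)) =
    cnt n (fun s => DOne r s ∧ i ∈ s ∧ (r + 1 ≤ s.count i ∧ s.count i ≤ 2 * r - 1)) +
      cnt n (fun s => 1 ≤ s.count i ∧ DZ r (s - Multiset.replicate 1 i)) := by
  have h1 : cnt n (fun s => r ≤ s.count i ∧ DZ r (s - Multiset.replicate r i)) =
      cnt n (fun s => DOne r s ∧ i ∈ s ∧ (r + 1 ≤ s.count i ∧ s.count i ≤ 2 * r - 1)) +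
      cnt n (fun s => s.count i = r ∧ ∀ j, j ≠ i → s.count j < r) := by
    apply cnt_split
    · intro s
      rw [DZ_sub, ← Multiset.count_pos]
      by_cases hc : r ≤ s.count i
      · rw [DOne_iff r i (by omega) s hc]
        by_cases hA : ∀ j, j ≠ i → s.count j < r
        · have hA' := iff_true_intro hA
          rw [hA']; simp only [and_true, true_and]; omega
        · simp [hA]
      · constructor
        · intro h; omega
        · rintro (h | h) <;> omega
    · rintro s h h'
      omega
  have h2 : cnt n (fun s => 1 ≤ s.count i ∧ DZ r (s - Multiset.replicate 1 i)) =
      cnt n (fun s => DZ r s ∧ i ∈ s ∧ True) +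
      cnt n (fun s => s.count i = r ∧ ∀ j, j ≠ i → s.count j < r) := by
    apply cnt_split
    · intro s
      rw [DZ_sub, ← Multiset.count_pos, DZ_iff r i]
      by_cases hA : ∀ j, j ≠ i → s.count j < r
      · have hA' := iff_true_intro hA
        rw [hA']; simp only [and_true, true_and]; omega
      · simp [hA]
    · rintro s h h'
      rw [DZ_iff r i] at h
      omega
  rw [h1, h2]
  ring

lemma keyO (n r i : ℕ) :
    cnt n (fun s => OZ r s ∧ i ∈ s ∧ True) =
    if r ∣ i then 0 else
      cnt n (fun s => 1 ≤ s.count i ∧ OZ r (s - Multiset.replicate 1 i)) := by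
  split_ifs with h
  · exact cnt_false _ fun s hs => hs.1 i hs.2.1 h
  · apply cnt_congr
    intro s
    rw [Multiset.one_le_count_iff_mem]
    constructor
    · rintro ⟨h1, h2, _⟩
      exact ⟨h2, fun j hj => h1 j (Multiset.mem_of_le (Multiset.sub_le_self _ _) hj)⟩
    · rintro ⟨h1, h2⟩
      refine ⟨fun j hj => ?_, h1, trivial⟩
      by_cases hji : j = i
      · rwa [hji]
      · apply h2
        rw [← Multiset.count_pos, Multiset.count_sub, Multiset.count_replicate]
        simpa [Ne.symm hji, Multiset.count_pos] using hj

lemma reindex (n r : ℕ) (hr : 0 < r) (g : ℕ → ℕ) (hg : ∀ m, n < m → g m = 0) :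
    ∑ i ∈ Finset.Icc 1 n, g (r * i) = ∑ i ∈ Finset.Icc 1 n, if r ∣ i then g i else 0 := by
  rw [← Finset.sum_filter]
  symm
  apply Finset.sum_of_injOn (fun i => i / r)
  · intro a ha b hb hab
    simp only [Finset.coe_filter, Set.mem_ofPred_eq] at ha hb
    exact (Nat.div_left_inj ha.2 hb.2).1 hab
  · intro a ha
    simp only [Finset.coe_filter, Set.mem_ofPred_eq, Finset.mem_Icc, Finset.coe_Icc,
      Set.mem_Icc] at ha ⊢
    obtain ⟨⟨h1, h2⟩, c, rfl⟩ := ha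
    rw [Nat.mul_div_cancel_left _ hr]
    constructor
    · exact Nat.pos_of_ne_zero (by rintro rfl; simp at h1)
    · nlinarith
  · intro i hi hni
    apply hg
    by_contra hc
    apply hni
    rw [Finset.mem_Icc] at hi
    refine ⟨r * i, ?_, by simp [Nat.mul_div_cancel_left _ hr]⟩
    simp only [Finset.coe_filter, Set.mem_ofPred_eq, Finset.mem_Icc]
    exact ⟨⟨Nat.mul_pos hr hi.1, by omega⟩, dvd_mul_right _ _⟩
  · intro i hi
    rw [Finset.mem_filter] at hi
    rw [Nat.mul_div_cancel' hi.2]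

/-- Yang's second Beck-type identity: `b'_{0,r}(n) = T_{1,r}(n)`. -/
theorem yang_second_beck (n r : ℕ) (hr : 2 ≤ r) :
    bDiff' 0 r n = (Tcount 1 r n : ℤ) := by
  have hD : ∑ p ∈ setD 0 r n, numDistinctParts p =
      ∑ i ∈ Finset.Icc 1 n, cnt n (fun s => DZ r s ∧ i ∈ s ∧ True) := by
    refine sum_eq_cnt n (DZ r) _ ?_ (fun _ _ => True) (fun p => p.parts.toFinset) ?_
    · intro p
      simp only [setD, Finset.mem_filter, Finset.mem_univ, true_and, Finset.card_eq_zero,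
        Finset.filter_eq_empty_iff, Multiset.mem_toFinset, DZ, not_le]
      constructor
      · intro h i
        by_cases hi : i ∈ p.parts
        · exact h hi
        · rw [Multiset.count_eq_zero_of_notMem hi]; omega
      · exact fun h i _ => h i
    · simp
  have hO : ∑ p ∈ setO 0 r n, numDistinctParts p =
      ∑ i ∈ Finset.Icc 1 n, cnt n (fun s => OZ r s ∧ i ∈ s ∧ True) := by
    refine sum_eq_cnt n (OZ r) _ ?_ (fun _ _ => True) (fun p => p.parts.toFinset) ?_
    · intro p
      simp [setO, OZ, Finset.filter_eq_empty_iff]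
    · simp
  have hT : Tcount 1 r n = ∑ i ∈ Finset.Icc 1 n, cnt n (fun s => DOne r s ∧ i ∈ s ∧
      (r + 1 ≤ s.count i ∧ s.count i ≤ 2 * r - 1)) := by
    refine sum_eq_cnt n (DOne r) _ ?_
      (fun s i => r + 1 ≤ s.count i ∧ s.count i ≤ 2 * r - 1) _ ?_
    · intro p
      simp [setD, DOne]
    · simp
  let g : ℕ → ℕ := fun m => if m ≤ n then cnt (n - m) (DZ r) else 0
  have hO2 : ∑ p ∈ setO 0 r n, numDistinctParts p =
      ∑ i ∈ Finset.Icc 1 n, if r ∣ i then 0 else g i := by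
    rw [hO]
    refine Finset.sum_congr rfl fun i hi => ?_
    rw [keyO, cnt_shift n 1 i (Finset.mem_Icc.1 hi).1, ← glaisher _ _ (by omega)]
    simp [g]
  have hsum : ∑ p ∈ setD 0 r n, numDistinctParts p + ∑ i ∈ Finset.Icc 1 n, g (r * i) =
      Tcount 1 r n + ∑ i ∈ Finset.Icc 1 n, g i := by
    rw [hD, hT, ← Finset.sum_add_distrib, ← Finset.sum_add_distrib]
    refine Finset.sum_congr rfl fun i hi => ?_
    have h := key n r i hr
    rw [cnt_shift n 1 i (Finset.mem_Icc.1 hi).1, cnt_shift n r i (Finset.mem_Icc.1 hi).1,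
      one_mul] at h
    exact h
  have hg : ∑ i ∈ Finset.Icc 1 n, g i = ∑ i ∈ Finset.Icc 1 n, g (r * i) +
      ∑ p ∈ setO 0 r n, numDistinctParts p := by
    rw [hO2, reindex n r (by omega) g (fun m hm => by simp [g]; omega), ← Finset.sum_add_distrib]
    refine Finset.sum_congr rfl fun i _ => ?_
    split_ifs <;> simp
  unfold bDiff'
  rw [← Nat.cast_sum, ← Nat.cast_sum]
  omega
end

section
/- For all non-negative integers n, j and all integers r ≥ 2, b'_{≤j,r}(n) = T_{j+1,r}(n). -/
open Finset

namespace GlaisherAux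

open Classical in
/-- Multisets of positive integers with sum `n - k` (empty if `k > n`). -/
noncomputable def W (n k : ℕ) : Finset (Multiset ℕ) :=
  if k ≤ n then (Finset.univ : Finset (Nat.Partition (n - k))).image (fun p => p.parts) else ∅

lemma mem_W {n k : ℕ} {s : Multiset ℕ} : s ∈ W n k ↔ s.sum + k = n ∧ ∀ i ∈ s, 0 < i := by
  unfold W
  split_ifs with h
  · simp only [Finset.mem_image, Finset.mem_univ, true_and]
    constructor
    · rintro ⟨p, rfl⟩
      refine ⟨?_, fun i hi => p.parts_pos hi⟩
      rw [p.parts_sum]; omega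
    · rintro ⟨h1, h2⟩
      exact ⟨⟨s, fun {i} hi => h2 i hi, by omega⟩, rfl⟩
  · constructor
    · intro h; simp at h
    · rintro ⟨h1, h2⟩; omega

/-- Sums over partitions are sums over `W n 0`. -/
lemma sum_part {M : Type*} [AddCommMonoid M] (n : ℕ) (Q : Multiset ℕ → Prop) [DecidablePred Q]
    (f : Multiset ℕ → M) :
    ∑ p ∈ (Finset.univ : Finset (Nat.Partition n)).filter (fun p => Q p.parts), f p.parts
      = ∑ s ∈ (W n 0).filter Q, f s := by
  refine Finset.sum_bij (fun p _ => p.parts) ?_ ?_ ?_ ?_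
  · intro p hp
    simp only [Finset.mem_filter, Finset.mem_univ, true_and] at hp
    simp only [Finset.mem_filter, mem_W]
    exact ⟨⟨by simp [p.parts_sum], fun i hi => p.parts_pos hi⟩, hp⟩
  · intro p _ q _ h
    exact Nat.Partition.ext h
  · intro s hs
    simp only [Finset.mem_filter, mem_W] at hs
    exact ⟨⟨s, fun {i} hi => hs.1.2 i hi, by simpa using hs.1.1⟩, by simpa using hs.2, rfl⟩
  · intros; rfl

lemma card_part (n k : ℕ) (hk : k ≤ n) (Q : Multiset ℕ → Prop) [DecidablePred Q] :
    #((W n k).filter Q)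
      = #((Finset.univ : Finset (Nat.Partition (n - k))).filter (fun p => Q p.parts)) := by
  symm
  refine Finset.card_bij (fun p _ => p.parts) ?_ ?_ ?_
  · intro p hp
    simp only [Finset.mem_filter, Finset.mem_univ, true_and] at hp
    simp only [Finset.mem_filter, mem_W]
    exact ⟨⟨by rw [p.parts_sum]; omega, fun i hi => p.parts_pos hi⟩, hp⟩
  · intro p _ q _ h
    exact Nat.Partition.ext h
  · intro s hs
    simp only [Finset.mem_filter, mem_W] at hs
    exact ⟨⟨s, fun {i} hi => hs.1.2 i hi, by omega⟩, by simpa using hs.2, rfl⟩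

/-- Adding a fixed multiset. -/
lemma card_shift (n k k' : ℕ) (A : Multiset ℕ) (hA : ∀ i ∈ A, 0 < i) (hk : k' = k + A.sum)
    (Q Q' : Multiset ℕ → Prop) [DecidablePred Q] [DecidablePred Q']
    (h : ∀ c, (∀ x ∈ c, 0 < x) → (Q' c ↔ Q (c + A)))
    (hle : ∀ s, Q s → A ≤ s) :
    #((W n k).filter Q) = #((W n k').filter Q') := by
  subst hk
  refine Finset.card_nbij' (fun s => s - A) (fun c => c + A) ?_ ?_ ?_ ?_
  · intro s hs
    simp only [Finset.coe_filter, mem_W, Set.mem_ofPred_eq] at hs ⊢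
    obtain ⟨⟨h1, h2⟩, h3⟩ := hs
    obtain ⟨c, rfl⟩ := Multiset.le_iff_exists_add.1 (hle s h3)
    rw [add_tsub_cancel_left]
    have hc : ∀ x ∈ c, 0 < x := fun x hx => h2 x (by simp [hx])
    refine ⟨⟨?_, hc⟩, (h c hc).2 (by rwa [add_comm])⟩
    rw [Multiset.sum_add] at h1; omega
  · intro c hc
    simp only [Finset.coe_filter, mem_W, Set.mem_ofPred_eq] at hc ⊢
    obtain ⟨⟨h1, h2⟩, h3⟩ := hc
    refine ⟨⟨?_, ?_⟩, (h c h2).1 h3⟩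
    · rw [Multiset.sum_add]; omega
    · intro i hi
      rcases Multiset.mem_add.1 hi with hi | hi
      · exact h2 i hi
      · exact hA i hi
  · intro s hs
    simp only [Finset.coe_filter, mem_W, Set.mem_ofPred_eq] at hs
    exact tsub_add_cancel_of_le (hle s hs.2)
  · intro c _
    exact add_tsub_cancel_right c A

/-- Number of different parts repeated at least `r` times. -/
def dc (r : ℕ) (s : Multiset ℕ) : ℕ := (s.toFinset.filter fun i => r ≤ s.count i).card

/-- Number of different parts divisible by `r`. -/
def oc (r : ℕ) (s : Multiset ℕ) : ℕ := (s.toFinset.filter fun i => r ∣ i).card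

/-- The quotient multiset on the repeated side. -/
def bD (r : ℕ) (s : Multiset ℕ) : Multiset ℕ :=
  ∑ i ∈ s.toFinset, Multiset.replicate (s.count i / r) i

/-- The quotient multiset on the divisible side. -/
def bO (r : ℕ) (s : Multiset ℕ) : Multiset ℕ := (s.filter fun i => r ∣ i).map (fun i => i / r)

lemma count_bD (r : ℕ) (s : Multiset ℕ) (i : ℕ) : (bD r s).count i = s.count i / r := by
  unfold bD
  rw [Multiset.count_sum']
  simp only [Multiset.count_replicate]
  rw [Finset.sum_ite_eq']
  split_ifs with h
  · rfl
  · rw [Multiset.count_eq_zero.2 (by simpa using h)]; simp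

lemma count_bO {r : ℕ} (hr : 0 < r) (s : Multiset ℕ) (i : ℕ) :
    (bO r s).count i = s.count (r * i) := by
  unfold bO
  rw [Multiset.count_map, Multiset.filter_filter, Multiset.count_eq_card_filter_eq]
  congr 1
  apply Multiset.filter_congr
  intro x _
  constructor
  · rintro ⟨rfl, h⟩; exact Nat.mul_div_cancel' h
  · rintro rfl; exact ⟨(Nat.mul_div_cancel_left i hr).symm, dvd_mul_right _ _⟩

lemma mem_bD {r : ℕ} (hr : 0 < r) (s : Multiset ℕ) (i : ℕ) : i ∈ bD r s ↔ r ≤ s.count i := by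
  rw [← Multiset.count_pos, count_bD, Nat.div_pos_iff]
  exact ⟨fun h => h.2, fun h => ⟨hr, h⟩⟩

lemma mem_bO {r : ℕ} (hr : 0 < r) (s : Multiset ℕ) (i : ℕ) : i ∈ bO r s ↔ r * i ∈ s := by
  rw [← Multiset.count_pos, count_bO hr, Multiset.count_pos]

lemma dc_eq {r : ℕ} (hr : 0 < r) (s : Multiset ℕ) : dc r s = (bD r s).toFinset.card := by
  unfold dc
  congr 1
  ext i
  simp only [Finset.mem_filter, Multiset.mem_toFinset, mem_bD hr]
  constructor
  · exact fun h => h.2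
  · intro h; exact ⟨Multiset.count_pos.1 (by omega), h⟩

lemma oc_eq {r : ℕ} (hr : 0 < r) (s : Multiset ℕ) : oc r s = (bO r s).toFinset.card := by
  unfold oc
  symm
  refine Finset.card_nbij' (fun i => r * i) (fun i => i / r) ?_ ?_ ?_ ?_
  · intro i hi
    simp [mem_bO hr] at hi ⊢
    exact hi
  · intro i hi
    simp [mem_bO hr] at hi ⊢
    rw [Nat.mul_div_cancel' hi.2]; exact hi.1
  · intro i _
    exact Nat.mul_div_cancel_left i hr
  · intro i hi
    simp at hi
    exact Nat.mul_div_cancel' hi.2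

lemma glaisher (n k r : ℕ) (hr : 0 < r) :
    #((W n k).filter fun c => ∀ i ∈ c, c.count i < r) = #((W n k).filter fun c => ∀ i ∈ c, ¬ r ∣ i) := by
  by_cases hk : k ≤ n
  · rw [card_part n k hk, card_part n k hk]
    exact (Nat.Partition.card_restricted_eq_card_countRestricted (n - k) hr).symm
  · have : W n k = ∅ := by simp [W, hk]
    rw [this]; rfl

lemma fiber (n k r : ℕ) (hr : 0 < r) (B : Multiset ℕ) :
    #((W n k).filter fun s => bD r s = B) = #((W n k).filter fun s => bO r s = B) := by
  by_cases hB : ∀ i ∈ B, 0 < i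
  · rw [card_shift n k (k + r * B.sum) (r • B) ?_ ?_ (fun s => bD r s = B)
      (fun c => ∀ i ∈ c, c.count i < r) ?_ ?_, glaisher n _ r hr]
    · symm
      apply card_shift n k (k + r * B.sum) (B.map (fun i => r * i))
      · intro i hi
        obtain ⟨a, ha, rfl⟩ := Multiset.mem_map.1 hi
        exact Nat.mul_pos hr (hB a ha)
      · rw [Multiset.sum_map_mul_left, Multiset.map_id']
      · intro c _
        have hmap : ∀ i, (B.map (fun i => r * i)).count (r * i) = B.count i := fun i =>
          Multiset.count_map_eq_count' _ _ (fun a b h => Nat.eq_of_mul_eq_mul_left hr h) i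
        constructor
        · intro h
          ext i
          rw [count_bO hr, Multiset.count_add, hmap, Multiset.count_eq_zero.2, zero_add]
          intro hi
          exact h _ hi (dvd_mul_right _ _)
        · rintro h i hi ⟨a, rfl⟩
          have := congrArg (Multiset.count a) h
          rw [count_bO hr, Multiset.count_add, hmap] at this
          have := Multiset.count_pos.2 hi
          omega
      · rintro s rfl
        unfold bO
        rw [Multiset.map_map]
        refine le_trans (le_of_eq ?_) (Multiset.filter_le (fun i => r ∣ i) s)
        conv_rhs => rw [← Multiset.map_id (Multiset.filter (fun i => r ∣ i) s)]
        apply Multiset.map_congr rfl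
        intro x hx
        exact Nat.mul_div_cancel' (Multiset.mem_filter.1 hx).2
    · intro i hi
      exact hB i (Multiset.mem_of_mem_nsmul hi)
    · rw [Multiset.sum_nsmul, smul_eq_mul]
    · intro c _
      constructor
      · intro h
        ext i
        rw [count_bD, Multiset.count_add, Multiset.count_nsmul, Nat.add_mul_div_left _ _ hr,
          Nat.div_eq_of_lt, zero_add]
        by_cases hi : i ∈ c
        · exact h i hi
        · rw [Multiset.count_eq_zero.2 hi]; exact hr
      · intro h i _
        have := congrArg (Multiset.count i) h
        rw [count_bD, Multiset.count_add, Multiset.count_nsmul, Nat.add_mul_div_left _ _ hr] at this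
        have h0 : c.count i / r = 0 := by omega
        rcases Nat.div_eq_zero_iff.1 h0 with h | h <;> omega
    · rintro s rfl
      rw [Multiset.le_iff_count]
      intro i
      rw [Multiset.count_nsmul, count_bD]
      exact Nat.mul_div_le _ _
  · push Not at hB
    obtain ⟨i, hi, h0⟩ := hB
    obtain rfl : i = 0 := by omega
    rw [Finset.filter_false_of_mem, Finset.filter_false_of_mem]
    · rintro s hs rfl
      rw [mem_bO hr] at hi
      exact absurd ((mem_W.1 hs).2 _ hi) (by simp)
    · rintro s hs rfl
      rw [mem_bD hr] at hi
      exact absurd ((mem_W.1 hs).2 0 (Multiset.count_pos.1 (by omega))) (by simp)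

lemma equid (n k r : ℕ) (hr : 0 < r) (Q : Multiset ℕ → Prop) [DecidablePred Q] :
    #((W n k).filter fun s => Q (bD r s)) = #((W n k).filter fun s => Q (bO r s)) := by
  have h : Multiset.map (bD r) (W n k).val = Multiset.map (bO r) (W n k).val := by
    ext B
    rw [Multiset.count_map, Multiset.count_map]
    have := fiber n k r hr B
    simp only [Finset.card_def, Finset.filter_val] at this
    simpa only [eq_comm] using this
  have h2 := congrArg (Multiset.countP Q) h
  rw [Multiset.countP_map, Multiset.countP_map] at h2
  exact h2

lemma dc_add {r : ℕ} (hr : 0 < r) (s : Multiset ℕ) (m i : ℕ) (h1 : s.count i < r)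
    (h2 : r ≤ s.count i + m) : dc r (s + Multiset.replicate m i) = dc r s + 1 := by
  rw [dc_eq hr, dc_eq hr, ← Finset.card_insert_of_notMem (a := i)]
  · congr 1
    ext x
    simp only [Multiset.mem_toFinset, Finset.mem_insert, mem_bD hr, Multiset.count_add,
      Multiset.count_replicate]
    by_cases hx : i = x
    · subst hx; simp [h2]
    · simp [hx, Ne.symm hx]
  · simp only [Multiset.mem_toFinset, mem_bD hr]; omega

lemma dc_add' {r : ℕ} (hr : 0 < r) (s : Multiset ℕ) (m i : ℕ)
    (h2 : s.count i + m < r ∨ r ≤ s.count i) : dc r (s + Multiset.replicate m i) = dc r s := by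
  rw [dc_eq hr, dc_eq hr]
  congr 1
  ext x
  simp only [Multiset.mem_toFinset, mem_bD hr, Multiset.count_add,
    Multiset.count_replicate]
  by_cases hx : i = x
  · subst hx; simp; omega
  · simp [hx]

lemma oc_add {r : ℕ} (s : Multiset ℕ) (i : ℕ) (h1 : i ∉ s) (h2 : r ∣ i) :
    oc r (s + {i}) = oc r s + 1 := by
  unfold oc
  rw [← Finset.card_insert_of_notMem (a := i)]
  · congr 1
    ext x
    simp only [Multiset.mem_toFinset, Finset.mem_insert, Finset.mem_filter, Multiset.mem_add,
      Multiset.mem_singleton]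
    by_cases hx : x = i
    · subst hx; simp [h2]
    · simp [hx]
  · simp [h1]

lemma oc_add' {r : ℕ} (s : Multiset ℕ) (i : ℕ) (h1 : i ∈ s ∨ ¬ r ∣ i) :
    oc r (s + {i}) = oc r s := by
  unfold oc
  congr 1
  ext x
  simp only [Multiset.mem_toFinset, Finset.mem_filter, Multiset.mem_add,
    Multiset.mem_singleton]
  by_cases hx : x = i
  · subst hx; tauto
  · simp [hx]

lemma stepD (n j r i : ℕ) (hr : 2 ≤ r) (hi : 0 < i) :
    #((W n 0).filter fun s => dc r s ≤ j ∧ i ∈ s)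
      + #((W n i).filter fun s => dc r s = j ∧ s.count i = r - 1)
      = #((W n i).filter fun s => dc r s ≤ j) := by
  have hr0 : 0 < r := by omega
  rw [card_shift n 0 i {i} (by simpa using hi) (by simp) (fun s => dc r s ≤ j ∧ i ∈ s)
    (fun s => dc r s ≤ j ∧ ¬ (dc r s = j ∧ s.count i = r - 1))]
  · rw [← Finset.filter_filter (fun s => dc r s ≤ j),
      ← Finset.card_filter_add_card_filter_not (s := (W n i).filter fun s => dc r s ≤ j)
        (fun s => dc r s = j ∧ s.count i = r - 1), add_comm]
    congr 2
    rw [Finset.filter_filter]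
    apply Finset.filter_congr
    intro s _
    constructor
    · intro h; exact ⟨h.1.le, h⟩
    · intro h; exact h.2
  · intro c _
    rw [← Multiset.replicate_one]
    by_cases h : c.count i = r - 1
    · rw [dc_add hr0 c 1 i (by omega) (by omega)]
      simp [h]; omega
    · rw [dc_add' hr0 c 1 i (by omega)]
      simp [h]
  · intro s hs
    simpa using hs.2

lemma stepO (n j r i : ℕ) (hi : 0 < i) :
    #((W n 0).filter fun s => oc r s ≤ j ∧ i ∈ s)
      + #((W n i).filter fun s => oc r s = j ∧ r ∣ i ∧ i ∉ s)
      = #((W n i).filter fun s => oc r s ≤ j) := by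
  rw [card_shift n 0 i {i} (by simpa using hi) (by simp) (fun s => oc r s ≤ j ∧ i ∈ s)
    (fun s => oc r s ≤ j ∧ ¬ (oc r s = j ∧ r ∣ i ∧ i ∉ s))]
  · rw [← Finset.filter_filter (fun s => oc r s ≤ j),
      ← Finset.card_filter_add_card_filter_not (s := (W n i).filter fun s => oc r s ≤ j)
        (fun s => oc r s = j ∧ r ∣ i ∧ i ∉ s), add_comm]
    congr 2
    rw [Finset.filter_filter]
    apply Finset.filter_congr
    intro s _
    constructor
    · intro h; exact ⟨h.1.le, h⟩
    · intro h; exact h.2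
  · intro c _
    by_cases h : r ∣ i ∧ i ∉ c
    · rw [oc_add c i h.2 h.1]
      simp [h]; omega
    · rw [oc_add' c i (by tauto)]
      simp only [h, and_false, not_false_eq_true, and_true]
      simp
  · intro s hs
    simpa using hs.2

lemma stepT (n j r i : ℕ) (hr : 2 ≤ r) (hi : 0 < i) :
    #((W n 0).filter fun s => dc r s = j + 1 ∧ (r + 1 ≤ s.count i ∧ s.count i ≤ 2 * r - 1))
      = #((W n (r * i)).filter fun s => dc r s = j ∧ (1 ≤ s.count i ∧ s.count i < r)) := by
  have hr0 : 0 < r := by omega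
  apply card_shift n 0 (r * i) (Multiset.replicate r i)
  · intro x hx; rw [Multiset.eq_of_mem_replicate hx]; exact hi
  · simp
  · intro c _
    by_cases h : c.count i < r
    · rw [dc_add hr0 c r i h (by omega)]
      simp; omega
    · simp; omega
  · intro s hs
    rw [← Multiset.le_count_iff_replicate_le]; omega

lemma stepS (n j r i : ℕ) (hr : 2 ≤ r) (hi : 0 < i) :
    #((W n i).filter fun s => dc r s = j ∧ s.count i = r - 1)
      = #((W n (r * i)).filter fun s => dc r s = j ∧ s.count i = 0) := by
  have hr0 : 0 < r := by omega
  apply card_shift n i (r * i) (Multiset.replicate (r - 1) i)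
  · intro x hx; rw [Multiset.eq_of_mem_replicate hx]; exact hi
  · simp
    obtain ⟨t, rfl⟩ : ∃ t, r = t + 1 := ⟨r - 1, by omega⟩
    simp; ring
  · intro c _
    by_cases h : c.count i = 0
    · rw [dc_add' hr0 c (r - 1) i (by omega)]
      simp [h]
    · simp [h]
  · intro s hs
    rw [← Multiset.le_count_iff_replicate_le]; omega

lemma stepM (n j r i : ℕ) (hr : 2 ≤ r) (hi : 0 < i) :
    #((W n (r * i)).filter fun s => oc r s = j ∧ r * i ∉ s)
      = #((W n 0).filter fun s => dc r s = j + 1 ∧ (r + 1 ≤ s.count i ∧ s.count i ≤ 2 * r - 1))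
        + #((W n i).filter fun s => dc r s = j ∧ s.count i = r - 1) := by
  have hr0 : 0 < r := by omega
  rw [stepT n j r i hr hi, stepS n j r i hr hi]
  have := equid n (r * i) r hr0 (fun B => B.toFinset.card = j ∧ i ∉ B)
  simp only [← dc_eq hr0, ← oc_eq hr0, mem_bD hr0, mem_bO hr0] at this
  rw [← this, ← Finset.card_union_of_disjoint]
  · congr 1
    ext s
    simp only [Finset.mem_union, Finset.mem_filter]
    have : s.count i < r ↔ (1 ≤ s.count i ∧ s.count i < r) ∨ s.count i = 0 := by omega
    rw [not_le, this]; tauto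
  · rw [Finset.disjoint_filter]
    intro s _ h1 h2; omega

/-- Double counting. -/
lemma dcount (n : ℕ) (Q : Multiset ℕ → Prop) [DecidablePred Q] (R : ℕ → Multiset ℕ → Prop)
    [∀ i, DecidablePred (R i)] (hR : ∀ i s, R i s → i ∈ s) :
    ∑ s ∈ (W n 0).filter Q, #(s.toFinset.filter fun i => R i s)
      = ∑ i ∈ Finset.Icc 1 n, #((W n 0).filter fun s => Q s ∧ R i s) := by
  have h1 : ∀ s ∈ (W n 0).filter Q, #(s.toFinset.filter fun i => R i s)
      = #((Finset.Icc 1 n).filter fun i => R i s) := by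
    intro s hs
    simp only [Finset.mem_filter, mem_W] at hs
    congr 1
    ext i
    simp only [Finset.mem_filter, Multiset.mem_toFinset, Finset.mem_Icc]
    constructor
    · rintro ⟨h, h'⟩
      have := Multiset.le_sum_of_mem h
      exact ⟨⟨hs.1.2 i h, by omega⟩, h'⟩
    · rintro ⟨_, h'⟩; exact ⟨hR i s h', h'⟩
  rw [Finset.sum_congr rfl h1]
  simp only [← Finset.filter_filter]
  exact Finset.sum_card_bipartiteAbove_eq_sum_card_bipartiteBelow (fun s i => R i s)

lemma reindex (n j r : ℕ) (hr : 2 ≤ r) :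
    ∑ i ∈ Finset.Icc 1 n, #((W n i).filter fun s => oc r s = j ∧ r ∣ i ∧ i ∉ s)
      = ∑ i ∈ Finset.Icc 1 n, #((W n (r * i)).filter fun s => oc r s = j ∧ r * i ∉ s) := by
  have hr0 : 0 < r := by omega
  symm
  refine Finset.sum_bij_ne_zero (fun i _ _ => r * i) ?_ ?_ ?_ ?_
  · intro i hi h
    rw [Finset.mem_Icc] at hi ⊢
    obtain ⟨s, hs⟩ := Finset.card_ne_zero.1 h
    have := (mem_W.1 (Finset.mem_filter.1 hs).1).1
    exact ⟨Nat.mul_pos hr0 hi.1, by omega⟩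
  · intro a _ _ b _ _ h
    exact Nat.eq_of_mul_eq_mul_left hr0 h
  · intro b hb h
    obtain ⟨s, hs⟩ := Finset.card_ne_zero.1 h
    obtain ⟨_, h1, ⟨a, rfl⟩, h2⟩ := Finset.mem_filter.1 hs
    rw [Finset.mem_Icc] at hb
    refine ⟨a, ?_, ?_, rfl⟩
    · rw [Finset.mem_Icc]
      have ha : 0 < a := Nat.pos_of_mul_pos_left hb.1
      exact ⟨ha, (Nat.le_mul_of_pos_left a hr0).trans hb.2⟩
    · simpa using h
  · intro i _ _
    simp

end GlaisherAux

open GlaisherAux in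
/-- `b'_{≤j,r}(n) = T_{j+1,r}(n)`. -/
theorem bDiffLe'_eq (n j r : ℕ) (hr : 2 ≤ r) :
    bDiffLe' j r n = (Tcount (j + 1) r n : ℤ) := by
  have hr0 : 0 < r := by omega
  have hD : ∑ p ∈ setDle j r n, numDistinctParts p
      = ∑ i ∈ Finset.Icc 1 n, #((W n 0).filter fun s => dc r s ≤ j ∧ i ∈ s) := by
    rw [← dcount n (fun s => dc r s ≤ j) (fun i s => i ∈ s) (fun _ _ h => h)]
    refine Eq.trans (sum_part n (fun s => dc r s ≤ j) (fun s => #s.toFinset)) ?_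
    apply Finset.sum_congr rfl
    intro s _
    rw [Finset.filter_true_of_mem (by simp)]
  have hO : ∑ p ∈ setOle j r n, numDistinctParts p
      = ∑ i ∈ Finset.Icc 1 n, #((W n 0).filter fun s => oc r s ≤ j ∧ i ∈ s) := by
    rw [← dcount n (fun s => oc r s ≤ j) (fun i s => i ∈ s) (fun _ _ h => h)]
    refine Eq.trans (sum_part n (fun s => oc r s ≤ j) (fun s => #s.toFinset)) ?_
    apply Finset.sum_congr rfl
    intro s _
    rw [Finset.filter_true_of_mem (by simp)]
  have hT : Tcount (j + 1) r n = ∑ i ∈ Finset.Icc 1 n, #((W n 0).filter fun s =>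
      dc r s = j + 1 ∧ (r + 1 ≤ s.count i ∧ s.count i ≤ 2 * r - 1)) := by
    rw [← dcount n (fun s => dc r s = j + 1)
      (fun i s => r + 1 ≤ s.count i ∧ s.count i ≤ 2 * r - 1)
      (fun i s h => Multiset.count_pos.1 (by omega))]
    exact sum_part n (fun s => dc r s = j + 1)
      (fun s => #(s.toFinset.filter fun i => r + 1 ≤ s.count i ∧ s.count i ≤ 2 * r - 1))
  have hI : ∀ i ∈ Finset.Icc 1 n, 0 < i := fun i hi => (Finset.mem_Icc.1 hi).1
  have e1 := Finset.sum_congr rfl (fun i hi => stepD n j r i hr (hI i hi))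
  have e2 := Finset.sum_congr rfl (fun i hi => stepO n j r i (hI i hi))
  have e3 := Finset.sum_congr rfl (fun i hi => stepM n j r i hr (hI i hi))
  have e4 : ∑ i ∈ Finset.Icc 1 n, #((W n i).filter fun s => dc r s ≤ j)
      = ∑ i ∈ Finset.Icc 1 n, #((W n i).filter fun s => oc r s ≤ j) := by
    apply Finset.sum_congr rfl
    intro i _
    have := equid n i r hr0 (fun B => B.toFinset.card ≤ j)
    simpa only [← dc_eq hr0, ← oc_eq hr0] using this
  rw [Finset.sum_add_distrib] at e1 e2 e3
  rw [reindex n j r hr] at e2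
  unfold bDiffLe'
  rw [← Nat.cast_sum, ← Nat.cast_sum, hD, hO, hT]
  omega
end

section
/- Let r ≥ 2 be an integer and let (S₁, S₂) be an Euler pair of order r, i.e., rS₁ ⊆ S₁ and S₂ = S₁ \ rS₁. Then for all non-negative integers n and j, b̃_{≤j,r}(n) = (r−1)·(j+1)·|Õ_{j+1,r}(n)| = (r−1)·(j+1)·|D̃_{j+1,r}(n)|. -/
open Finset

/-- `rS`: the set `{r·s : s ∈ S}` of `r`-fold multiples of elements of `S`. -/
def rSet (r : ℕ) (S : Set ℕ) : Set ℕ := (fun s => r * s) '' S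

/-- `Õ_{j,r}(n)`: partitions of `n` with exactly `j` different parts from `rS₁` and all
other parts from `S₂`. -/
noncomputable def setOt (S1 S2 : Set ℕ) (j r n : ℕ) : Finset (Nat.Partition n) :=
  letI := Classical.propDecidable
  Finset.univ.filter fun p =>
    (p.parts.toFinset.filter fun i => i ∈ rSet r S1).card = j ∧
      ∀ i ∈ p.parts.toFinset, i ∉ rSet r S1 → i ∈ S2

/-- `D̃_{j,r}(n)`: partitions of `n` with all parts in `S₁` and exactly `j` different parts
repeated at least `r` times (all other parts appearing at most `r - 1` times). -/
noncomputable def setDt (S1 : Set ℕ) (j r n : ℕ) : Finset (Nat.Partition n) :=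
  letI := Classical.propDecidable
  Finset.univ.filter fun p =>
    (∀ i ∈ p.parts, i ∈ S1) ∧
      (p.parts.toFinset.filter fun i => r ≤ p.parts.count i).card = j

/-- `Õ_{≤j,r}(n)`: partitions of `n` with at most `j` different parts from `rS₁` and all
other parts from `S₂`. -/
noncomputable def setOtLe (S1 S2 : Set ℕ) (j r n : ℕ) : Finset (Nat.Partition n) :=
  letI := Classical.propDecidable
  Finset.univ.filter fun p =>
    (p.parts.toFinset.filter fun i => i ∈ rSet r S1).card ≤ j ∧
      ∀ i ∈ p.parts.toFinset, i ∉ rSet r S1 → i ∈ S2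

/-- `D̃_{≤j,r}(n)`: partitions of `n` with all parts in `S₁` and at most `j` different parts
repeated at least `r` times. -/
noncomputable def setDtLe (S1 : Set ℕ) (j r n : ℕ) : Finset (Nat.Partition n) :=
  letI := Classical.propDecidable
  Finset.univ.filter fun p =>
    (∀ i ∈ p.parts, i ∈ S1) ∧
      (p.parts.toFinset.filter fun i => r ≤ p.parts.count i).card ≤ j

/-- `b̃_{j,r}(n)`: the difference between the number of parts in all partitions in
`Õ_{j,r}(n)` and the number of parts in all partitions in `D̃_{j,r}(n)`. -/
noncomputable def bDifft (S1 S2 : Set ℕ) (j r n : ℕ) : ℤ :=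
  (∑ p ∈ setOt S1 S2 j r n, (numParts p : ℤ)) - ∑ p ∈ setDt S1 j r n, (numParts p : ℤ)

/-- `b̃_{≤j,r}(n)`. -/
noncomputable def bDifftLe (S1 S2 : Set ℕ) (j r n : ℕ) : ℤ :=
  (∑ p ∈ setOtLe S1 S2 j r n, (numParts p : ℤ)) - ∑ p ∈ setDtLe S1 j r n, (numParts p : ℤ)

/-- `b̃'_{j,r}(n)`: the difference between the number of different parts in all partitions
in `D̃_{j,r}(n)` and the number of different parts in all partitions in `Õ_{j,r}(n)`. -/
noncomputable def bDifft' (S1 S2 : Set ℕ) (j r n : ℕ) : ℤ :=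
  (∑ p ∈ setDt S1 j r n, (numDistinctParts p : ℤ)) -
    ∑ p ∈ setOt S1 S2 j r n, (numDistinctParts p : ℤ)

/-- `b̃'_{≤j,r}(n)`. -/
noncomputable def bDifftLe' (S1 S2 : Set ℕ) (j r n : ℕ) : ℤ :=
  (∑ p ∈ setDtLe S1 j r n, (numDistinctParts p : ℤ)) -
    ∑ p ∈ setOtLe S1 S2 j r n, (numDistinctParts p : ℤ)

/-- `T̃_{j,r}(n)`: the number of different parts with multiplicity between `r + 1` and
`2r - 1` in all partitions in `D̃_{j,r}(n)`. -/
noncomputable def Tcountt (S1 : Set ℕ) (j r n : ℕ) : ℕ :=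
  ∑ p ∈ setDt S1 j r n,
    (p.parts.toFinset.filter fun i =>
      r + 1 ≤ p.parts.count i ∧ p.parts.count i ≤ 2 * r - 1).card

/-- `(S₁, S₂)` is an Euler pair of order `r` if `rS₁ ⊆ S₁` and `S₂ = S₁ \ rS₁`. -/
def IsEulerPair (r : ℕ) (S1 S2 : Set ℕ) : Prop :=
  rSet r S1 ⊆ S1 ∧ S2 = S1 \ rSet r S1

open Classical in
/-- partitions with all parts in `S` -/
noncomputable def auxA (S : Set ℕ) (n : ℕ) : Finset (Nat.Partition n) :=
  Finset.univ.filter fun p => ∀ i ∈ p.parts, i ∈ S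

open Classical in
noncomputable def auxa (S : Set ℕ) (r : ℕ) {n : ℕ} (p : Nat.Partition n) : ℕ :=
  (p.parts.toFinset.filter fun i => i ∈ rSet r S).card

open Classical in
noncomputable def auxb (r : ℕ) {n : ℕ} (p : Nat.Partition n) : ℕ :=
  (p.parts.toFinset.filter fun i => r ≤ p.parts.count i).card

open Classical in
noncomputable def auxW (S : Set ℕ) (n : ℕ) : Finset ℕ :=
  (Finset.range (n+1)).filter fun i => i ∈ S

open Classical in
noncomputable def auxO (S : Set ℕ) (r n : ℕ) (U : Finset ℕ) : Finset (Nat.Partition n) :=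
  (auxA S n).filter fun p => ∀ s ∈ U, r * s ∈ p.parts

open Classical in
noncomputable def auxD (S : Set ℕ) (r n : ℕ) (U : Finset ℕ) : Finset (Nat.Partition n) :=
  (auxA S n).filter fun p => ∀ s ∈ U, r ≤ p.parts.count s

theorem aux_le {n : ℕ} (p : Nat.Partition n) {i : ℕ} (h : i ∈ p.parts) : i ≤ n := by
  have := Multiset.le_sum_of_mem h
  rwa [p.parts_sum] at this

theorem aux_pow_a (S : Set ℕ) (r n : ℕ) (hr : 2 ≤ r) (p : Nat.Partition n)
    (x : Polynomial ℤ) : (x + 1) ^ auxa S r p =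
      ∑ U ∈ (auxW S n).powerset, if (∀ s ∈ U, r * s ∈ p.parts) then x ^ U.card else 0 := by
  classical
  have h : auxa S r p = ((auxW S n).filter fun s => r * s ∈ p.parts).card := by
    unfold auxa auxW
    symm
    refine Finset.card_bij (fun s _ => r * s) ?_ ?_ ?_
    · intro s hs
      simp only [Finset.mem_filter, Finset.mem_range, Multiset.mem_toFinset] at hs ⊢
      exact ⟨hs.2, ⟨s, hs.1.2, rfl⟩⟩
    · intro a _ b _ hab
      exact Nat.eq_of_mul_eq_mul_left (by omega) hab
    · intro b hb
      simp only [Finset.mem_filter, Multiset.mem_toFinset] at hb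
      obtain ⟨hb, s, hs, rfl⟩ := hb
      refine ⟨s, ?_, rfl⟩
      have := aux_le p hb
      simp only [Finset.mem_filter, Finset.mem_range]
      refine ⟨⟨?_, hs⟩, hb⟩
      simp only at this
      nlinarith
  rw [h, ← Finset.sum_pow_mul_eq_add_pow, ← Finset.sum_filter]
  refine Finset.sum_congr ?_ (by simp)
  ext U
  simp only [Finset.mem_powerset, Finset.mem_filter, Finset.subset_iff]
  grind

theorem aux_pow_b (S : Set ℕ) (r n : ℕ) (hr : 2 ≤ r) (p : Nat.Partition n) (hp : p ∈ auxA S n)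
    (x : Polynomial ℤ) : (x + 1) ^ auxb r p =
      ∑ U ∈ (auxW S n).powerset, if (∀ s ∈ U, r ≤ p.parts.count s) then x ^ U.card else 0 := by
  classical
  have h : auxb r p = ((auxW S n).filter fun s => r ≤ p.parts.count s).card := by
    unfold auxb auxW
    congr 1
    ext s
    simp only [auxA, Finset.mem_filter, Finset.mem_univ, true_and] at hp
    simp only [Finset.mem_filter, Finset.mem_range, Multiset.mem_toFinset]
    constructor
    · rintro ⟨h1, h2⟩
      have := aux_le p h1
      exact ⟨⟨by omega, hp s h1⟩, h2⟩
    · rintro ⟨h1, h2⟩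
      exact ⟨Multiset.count_pos.mp (by omega), h2⟩
  rw [h, ← Finset.sum_pow_mul_eq_add_pow, ← Finset.sum_filter]
  refine Finset.sum_congr ?_ (by simp)
  ext U
  simp only [Finset.mem_powerset, Finset.mem_filter, Finset.subset_iff]
  grind

theorem aux_leO (r n : ℕ) (hr : 2 ≤ r) (U : Finset ℕ) (p : Nat.Partition n) :
    (∀ s ∈ U, r * s ∈ p.parts) ↔ U.val.map (fun s => r * s) ≤ p.parts := by
  rw [Multiset.le_iff_subset]
  · rw [Multiset.subset_iff]; simp
  · exact U.nodup.map (fun a b hab => Nat.eq_of_mul_eq_mul_left (by omega) hab)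

theorem aux_leD (r n : ℕ) (U : Finset ℕ) (p : Nat.Partition n) :
    (∀ s ∈ U, r ≤ p.parts.count s) ↔ r • U.val ≤ p.parts := by
  classical
  rw [Multiset.le_iff_count]
  refine forall_congr' fun s => ?_
  rw [Multiset.count_nsmul, Multiset.count_eq_of_nodup U.nodup]
  by_cases h : s ∈ U <;> simp [h]

/-- replacing a submultiset -/
noncomputable def auxSwap {n : ℕ} (p : Nat.Partition n) (a b : Multiset ℕ) (h : a ≤ p.parts)
    (hab : a.sum = b.sum) (hb : ∀ i ∈ b, 0 < i) : Nat.Partition n where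
  parts := p.parts - a + b
  parts_pos := by
    intro i hi
    rcases Multiset.mem_add.mp hi with hi | hi
    · exact p.parts_pos (Multiset.mem_of_le (Multiset.sub_le_self _ _) hi)
    · exact hb i hi
  parts_sum := by
    rw [Multiset.sum_add, ← hab, ← Multiset.sum_add, Multiset.sub_add_cancel h, p.parts_sum]

theorem aux_bij (S : Set ℕ) (r n : ℕ) (hr : 2 ≤ r) (hS : ∀ s ∈ S, 0 < s)
    (hrS : rSet r S ⊆ S) (U : Finset ℕ) (hU : U ∈ (auxW S n).powerset) (f : ℕ → ℤ) :
    ∑ p ∈ auxO S r n U, f (numParts p + (r-1) * U.card) = ∑ p ∈ auxD S r n U, f (numParts p) := by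
  classical
  have hUS : ∀ s ∈ U, s ∈ S := by
    intro s hs
    have := Finset.mem_powerset.mp hU hs
    simp only [auxW, Finset.mem_filter] at this
    exact this.2
  have hm1 : ∀ i ∈ U.val.map (fun s => r * s), i ∈ S := by
    intro i hi
    obtain ⟨s, hs, rfl⟩ := Multiset.mem_map.mp hi
    exact hrS ⟨s, hUS s hs, rfl⟩
  have hm2 : ∀ i ∈ r • U.val, i ∈ S := by
    intro i hi
    exact hUS i (Multiset.mem_of_mem_nsmul hi)
  have hsum : (U.val.map (fun s => r * s)).sum = (r • U.val).sum := by
    rw [Multiset.sum_map_mul_left, Multiset.sum_nsmul]; simp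
  have hO : ∀ p : Nat.Partition n, p ∈ auxO S r n U ↔
      (∀ i ∈ p.parts, i ∈ S) ∧ U.val.map (fun s => r * s) ≤ p.parts := by
    intro p
    simp [auxO, auxA, ← aux_leO r n hr]
  have hD : ∀ p : Nat.Partition n, p ∈ auxD S r n U ↔
      (∀ i ∈ p.parts, i ∈ S) ∧ r • U.val ≤ p.parts := by
    intro p
    simp [auxD, auxA, ← aux_leD r n]
  refine Finset.sum_bij'
    (fun p hp => auxSwap p _ _ ((hO p).mp hp).2 hsum (fun i hi => hS i (hm2 i hi)))
    (fun p hp => auxSwap p _ _ ((hD p).mp hp).2 hsum.symm (fun i hi => hS i (hm1 i hi)))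
    ?_ ?_ ?_ ?_ ?_
  · intro p hp
    rw [hD]
    refine ⟨fun i hi => ?_, Multiset.le_add_left _ _⟩
    rcases Multiset.mem_add.mp hi with hi | hi
    · exact ((hO p).mp hp).1 i (Multiset.mem_of_le (Multiset.sub_le_self _ _) hi)
    · exact hm2 i hi
  · intro p hp
    rw [hO]
    refine ⟨fun i hi => ?_, Multiset.le_add_left _ _⟩
    rcases Multiset.mem_add.mp hi with hi | hi
    · exact ((hD p).mp hp).1 i (Multiset.mem_of_le (Multiset.sub_le_self _ _) hi)
    · exact hm1 i hi
  · intro p hp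
    ext1
    simp only [auxSwap, Multiset.add_sub_cancel_right]
    exact Multiset.sub_add_cancel ((hO p).mp hp).2
  · intro p hp
    ext1
    simp only [auxSwap, Multiset.add_sub_cancel_right]
    exact Multiset.sub_add_cancel ((hD p).mp hp).2
  · intro p hp
    congr 1
    simp only [numParts, auxSwap, Multiset.card_add, Multiset.card_nsmul, Finset.card_val]
    have h := Multiset.card_sub ((hO p).mp hp).2
    have h2 := Multiset.card_le_card ((hO p).mp hp).2
    simp only [Multiset.card_map, Finset.card_val] at h h2
    rw [h]
    obtain ⟨k, rfl⟩ : ∃ k, r = k + 1 := ⟨r - 1, by omega⟩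
    simp only [Nat.add_sub_cancel, smul_eq_mul, add_mul]
    omega

open Polynomial in
theorem aux_expand_a (S : Set ℕ) (r n : ℕ) (hr : 2 ≤ r) (f : ℕ → ℤ) :
    ∑ p ∈ auxA S n, C (f (numParts p)) * (X : ℤ[X]) ^ auxa S r p =
      ∑ U ∈ (auxW S n).powerset, C (∑ p ∈ auxO S r n U, f (numParts p)) * (X - 1) ^ U.card := by
  classical
  have h : ∀ p ∈ auxA S n, C (f (numParts p)) * (X : ℤ[X]) ^ auxa S r p =
      ∑ U ∈ (auxW S n).powerset, if (∀ s ∈ U, r * s ∈ p.parts) then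
        C (f (numParts p)) * (X - 1) ^ U.card else 0 := by
    intro p hp
    have := aux_pow_a S r n hr p (X - 1)
    rw [sub_add_cancel] at this
    rw [this, Finset.mul_sum]
    simp only [mul_ite, mul_zero]
  rw [Finset.sum_congr rfl h, Finset.sum_comm]
  refine Finset.sum_congr rfl fun U _ => ?_
  rw [← Finset.sum_filter, map_sum, Finset.sum_mul, auxO]

open Polynomial in
theorem aux_expand_b (S : Set ℕ) (r n : ℕ) (hr : 2 ≤ r) (f : ℕ → ℤ) :
    ∑ p ∈ auxA S n, C (f (numParts p)) * (X : ℤ[X]) ^ auxb r p =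
      ∑ U ∈ (auxW S n).powerset, C (∑ p ∈ auxD S r n U, f (numParts p)) * (X - 1) ^ U.card := by
  classical
  have h : ∀ p ∈ auxA S n, C (f (numParts p)) * (X : ℤ[X]) ^ auxb r p =
      ∑ U ∈ (auxW S n).powerset, if (∀ s ∈ U, r ≤ p.parts.count s) then
        C (f (numParts p)) * (X - 1) ^ U.card else 0 := by
    intro p hp
    have := aux_pow_b S r n hr p hp (X - 1)
    rw [sub_add_cancel] at this
    rw [this, Finset.mul_sum]
    simp only [mul_ite, mul_zero]
  rw [Finset.sum_congr rfl h, Finset.sum_comm]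
  refine Finset.sum_congr rfl fun U _ => ?_
  rw [← Finset.sum_filter, map_sum, Finset.sum_mul, auxD]

open Polynomial in
theorem aux_coeff {ι : Type*} (A : Finset ι) (a : ι → ℕ) (f : ι → ℤ) (i : ℕ) :
    (∑ p ∈ A, C (f p) * (X : ℤ[X]) ^ a p).coeff i = ∑ p ∈ A.filter (fun p => a p = i), f p := by
  rw [Polynomial.finsetSum_coeff, Finset.sum_filter]
  refine Finset.sum_congr rfl fun p _ => ?_
  rw [coeff_C_mul_X_pow]
  simp only [eq_comm]

theorem aux_le_sum {ι : Type*} (A : Finset ι) (a : ι → ℕ) (f : ι → ℤ) (j : ℕ) :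
    ∑ p ∈ A.filter (fun p => a p ≤ j), f p =
      ∑ i ∈ Finset.range (j + 1), ∑ p ∈ A.filter (fun p => a p = i), f p := by
  simp only [Finset.sum_filter]
  rw [Finset.sum_comm]
  refine Finset.sum_congr rfl fun p _ => ?_
  rw [Finset.sum_ite_eq]
  simp [Nat.lt_succ_iff]

open Polynomial in
theorem aux_tele (H : ℤ[X]) (j : ℕ) :
    ∑ i ∈ Finset.range (j + 1), ((1 - X) * H).coeff i = H.coeff j := by
  induction j with
  | zero => simp [sub_mul]
  | succ j ih => rw [Finset.sum_range_succ, ih]; simp [sub_mul, coeff_X_mul]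

/-- For an Euler pair `(S₁, S₂)` of order `r`,
`b̃_{≤j,r}(n) = (r-1)·(j+1)·|Õ_{j+1,r}(n)| = (r-1)·(j+1)·|D̃_{j+1,r}(n)|`. -/
theorem euler_pair_beck_le (r : ℕ) (hr : 2 ≤ r) (S1 S2 : Set ℕ)
    (hS1 : ∀ s ∈ S1, 0 < s) (hS2 : ∀ s ∈ S2, 0 < s)
    (hpair : IsEulerPair r S1 S2) (n j : ℕ) :
    bDifftLe S1 S2 j r n =
        ((r : ℤ) - 1) * ((j : ℤ) + 1) * ((setOt S1 S2 (j + 1) r n).card : ℤ) ∧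
      bDifftLe S1 S2 j r n =
        ((r : ℤ) - 1) * ((j : ℤ) + 1) * ((setDt S1 (j + 1) r n).card : ℤ) := by
  classical
  obtain ⟨hsub, rfl⟩ := hpair
  have hcond : ∀ p : Nat.Partition n, (∀ i ∈ p.parts.toFinset, i ∉ rSet r S1 → i ∈ S1 \ rSet r S1)
      ↔ p ∈ auxA S1 n := by
    intro p
    simp only [auxA, Finset.mem_filter, Finset.mem_univ, true_and, Multiset.mem_toFinset]
    refine forall₂_congr fun i _ => ?_
    constructor
    · intro h
      by_cases hi : i ∈ rSet r S1
      · exact hsub hi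
      · exact (h hi).1
    · exact fun h h' => ⟨h, h'⟩
  have eO : ∀ k, setOt S1 (S1 \ rSet r S1) k r n = (auxA S1 n).filter (fun p => auxa S1 r p = k) := by
    intro k
    ext p
    rw [Finset.mem_filter, setOt]
    refine Iff.trans (@Finset.mem_filter _ _ (_) _ _) ?_
    rw [← hcond, auxa]
    constructor
    · rintro ⟨_, h1, h2⟩
      exact ⟨by convert h2, by convert h1⟩
    · rintro ⟨h1, h2⟩
      exact ⟨Finset.mem_univ _, by convert h2, by convert h1⟩
  have eOl : setOtLe S1 (S1 \ rSet r S1) j r n =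
      (auxA S1 n).filter (fun p => auxa S1 r p ≤ j) := by
    ext p
    rw [Finset.mem_filter, setOtLe]
    refine Iff.trans (@Finset.mem_filter _ _ (_) _ _) ?_
    rw [← hcond, auxa]
    constructor
    · rintro ⟨_, h1, h2⟩
      exact ⟨by convert h2, by convert h1⟩
    · rintro ⟨h1, h2⟩
      exact ⟨Finset.mem_univ _, by convert h2, by convert h1⟩
  have eD : ∀ k, setDt S1 k r n = (auxA S1 n).filter (fun p => auxb r p = k) := by
    intro k
    ext p
    rw [Finset.mem_filter, setDt]
    refine Iff.trans (@Finset.mem_filter _ _ (_) _ _) ?_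
    rw [auxb, auxA, Finset.mem_filter]
    constructor
    · rintro ⟨h0, h1, h2⟩
      exact ⟨⟨h0, h1⟩, by convert h2⟩
    · rintro ⟨⟨h0, h1⟩, h2⟩
      exact ⟨h0, h1, by convert h2⟩
  have eDl : setDtLe S1 j r n = (auxA S1 n).filter (fun p => auxb r p ≤ j) := by
    ext p
    rw [Finset.mem_filter, setDtLe]
    refine Iff.trans (@Finset.mem_filter _ _ (_) _ _) ?_
    rw [auxb, auxA, Finset.mem_filter]
    constructor
    · rintro ⟨h0, h1, h2⟩
      exact ⟨⟨h0, h1⟩, by convert h2⟩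
    · rintro ⟨⟨h0, h1⟩, h2⟩
      exact ⟨h0, h1, by convert h2⟩
  have a1 := aux_expand_a S1 r n hr (fun _ => 1)
  have b1 := aux_expand_b S1 r n hr (fun _ => 1)
  have al := aux_expand_a S1 r n hr (fun k => (k : ℤ))
  have bl := aux_expand_b S1 r n hr (fun k => (k : ℤ))
  have hG : ∑ p ∈ auxA S1 n, Polynomial.C (1 : ℤ) * (Polynomial.X : Polynomial ℤ) ^ auxa S1 r p
      = ∑ p ∈ auxA S1 n, Polynomial.C (1 : ℤ) * (Polynomial.X : Polynomial ℤ) ^ auxb r p := by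
    rw [a1, b1]
    refine Finset.sum_congr rfl fun U hU => ?_
    rw [← aux_bij S1 r n hr hS1 hsub U hU (fun _ => 1)]
  have hcard : ((setOt S1 (S1 \ rSet r S1) (j + 1) r n).card : ℤ)
      = ((setDt S1 (j + 1) r n).card : ℤ) := by
    have := congrArg (fun P => Polynomial.coeff P (j + 1)) hG
    simp only [aux_coeff _ _ (fun _ => (1 : ℤ))] at this
    rw [eO, eD]
    simpa using this
  have hP : ∑ p ∈ auxA S1 n, Polynomial.C (numParts p : ℤ) * (Polynomial.X : Polynomial ℤ) ^ auxa S1 r p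
      - ∑ p ∈ auxA S1 n, Polynomial.C (numParts p : ℤ) * (Polynomial.X : Polynomial ℤ) ^ auxb r p
      = (1 - Polynomial.X) * (Polynomial.C ((r : ℤ) - 1) * Polynomial.derivative
        (∑ p ∈ auxA S1 n,
          Polynomial.C (1 : ℤ) * (Polynomial.X : Polynomial ℤ) ^ auxa S1 r p)) := by
    rw [a1, al, bl, ← Finset.sum_sub_distrib, Polynomial.derivative_sum, Finset.mul_sum,
      Finset.mul_sum]
    refine Finset.sum_congr rfl fun U hU => ?_
    rw [← aux_bij S1 r n hr hS1 hsub U hU (fun k => (k : ℤ))]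
    have h1 : ((r - 1 : ℕ) : ℤ) = (r : ℤ) - 1 := by
      rw [Nat.cast_sub (by omega)]; simp
    simp only [Nat.cast_add, Nat.cast_mul, h1, Finset.sum_add_distrib, Finset.sum_const,
      Polynomial.derivative_C_mul, Polynomial.derivative_pow, map_add, map_mul, map_sub,
      Polynomial.derivative_sub, Polynomial.derivative_X, Polynomial.derivative_one]
    rcases Nat.eq_zero_or_pos U.card with h0 | h0
    · simp [h0]
    · obtain ⟨k, hk⟩ : ∃ k, U.card = k + 1 := ⟨U.card - 1, by omega⟩
      rw [hk]
      simp
      ring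
  have hb : bDifftLe S1 (S1 \ rSet r S1) j r n =
      ((r : ℤ) - 1) * ((j : ℤ) + 1) * ((setOt S1 (S1 \ rSet r S1) (j + 1) r n).card : ℤ) := by
    rw [bDifftLe, eOl, eDl, aux_le_sum, aux_le_sum, ← Finset.sum_sub_distrib]
    simp only [← aux_coeff _ _ (fun p => (numParts p : ℤ)), ← Polynomial.coeff_sub]
    rw [hP, aux_tele, Polynomial.coeff_C_mul, Polynomial.coeff_derivative,
      aux_coeff _ _ (fun _ => (1 : ℤ)), eO]
    simp
    ring
  exact ⟨hb, hcard ▸ hb⟩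
end
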